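/- arXiv:2409.19353 — 2 statements merged into one kernel-verified Lean document; each statement's English description precedes it below -/
import Mathlib

section
/- Let n ≥ 1, let z₀ ∈ ℂⁿ, R > 0, and let B = B(z₀,R) ⊂ ℂⁿ be the open ball with boundary sphere ∂B. Let 1 ≤ p < ∞, 1 ≤ q < ∞, 1 ≤ r < ∞ satisfy q(2n−p) < 2np and q(2n−1) < 2nr. Then there exists a constant δ > 0, depending only on n, p, q, r, R, such that the following holds: for every f : ℂⁿ → ℂ that is continuous on cl(B) and continuously differentiable on B, and all continuous functions g₁, …, g_n on cl(B) satisfying g_j(z) = ∂f/∂z̄_j(z) for all z ∈ B and all j, one has δ·‖f‖_{L^q(B)} ≤ ‖(∑ⱼ₌₁ⁿ |g_j|²)^{1/2}‖_{L^p(B)} + ‖f‖_{L^r(∂B)}. (The Euclidean-ball case of Theorem 1.10.) -/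
open Metric MeasureTheory

noncomputable instance (n : ℕ) : MeasurableSpace (EuclideanSpace ℂ (Fin n)) := borel _
instance (n : ℕ) : BorelSpace (EuclideanSpace ℂ (Fin n)) := ⟨rfl⟩

/-- The conjugate Wirtinger derivative `∂f/∂z̄_j = ½(∂f/∂x_j + i ∂f/∂y_j)`. -/
noncomputable def wirtingerDBar (n : ℕ) (f : EuclideanSpace ℂ (Fin n) → ℂ)
    (z : EuclideanSpace ℂ (Fin n)) (j : Fin n) : ℂ :=
  (1 / 2 : ℂ) * (fderiv ℝ f z (EuclideanSpace.single j 1)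
    + Complex.I * fderiv ℝ f z (EuclideanSpace.single j Complex.I))

open scoped ENNReal

section

lemma dso_half_pow (k : ℕ) : ENNReal.ofReal ((1/2:ℝ)^k) = (2:ℝ≥0∞) ^ (-(k:ℝ)) := by
  rw [ENNReal.rpow_neg, ENNReal.rpow_natCast, ENNReal.ofReal_pow (by norm_num), one_div,
    ENNReal.ofReal_inv_of_pos (by norm_num), ENNReal.inv_pow]
  simp

lemma dso_rpow_anti {x y : ℝ≥0∞} {t : ℝ} (ht : 0 ≤ t) (h : x ≤ y) : y ^ (-t) ≤ x ^ (-t) := by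
  rw [ENNReal.rpow_neg, ENNReal.rpow_neg]
  exact ENNReal.inv_le_inv.2 (ENNReal.rpow_le_rpow h ht)

lemma dso_one_le_rpow {x : ℝ≥0∞} {t : ℝ} (h : 1 ≤ x) (ht : 0 ≤ t) : 1 ≤ x ^ t := by
  calc (1:ℝ≥0∞) = 1 ^ t := (ENNReal.one_rpow t).symm
    _ ≤ x ^ t := ENNReal.rpow_le_rpow h ht

lemma dso_riesz {E : Type*} [NormedAddCommGroup E] [MeasurableSpace E] [BorelSpace E]
    (m : Measure E) [IsFiniteMeasure m] (C : ℝ≥0∞) (hC : C ≠ ∞) (s t : ℝ) (ht : 0 ≤ t)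
    (hts : t < s) (hg : ∀ z : E, ∀ ρ : ℝ, 0 < ρ → m (closedBall z ρ) ≤ C * ENNReal.ofReal ρ ^ s) :
    ∃ A : ℝ≥0∞, A ≠ ∞ ∧ ∀ z : E, ∫⁻ ζ, ‖ζ - z‖ₑ ^ (-t) ∂m ≤ A := by
  refine ⟨m Set.univ + ∑' k : ℕ, (2:ℝ≥0∞)^t * C * ((2:ℝ≥0∞)^(-(s-t)))^k, ?_, fun z => ?_⟩
  · rw [ENNReal.tsum_mul_left, ENNReal.tsum_geometric]
    refine ENNReal.add_ne_top.2 ⟨measure_ne_top _ _, ENNReal.mul_ne_top (ENNReal.mul_ne_top ?_ hC) ?_⟩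
    · exact ENNReal.rpow_ne_top_of_nonneg ht (by simp)
    · have : (2:ℝ≥0∞)^(-(s-t)) < 1 := ENNReal.rpow_lt_one_of_one_lt_of_neg (by norm_num) (by linarith)
      simpa [tsub_eq_zero_iff_le] using this
  · have key : ∀ ζ : E, ‖ζ - z‖ₑ ^ (-t) ≤ 1 + ∑' k : ℕ,
        (closedBall z ((1/2:ℝ)^k)).indicator (fun _ => (2:ℝ≥0∞)^(((k:ℝ)+1)*t)) ζ := by
      intro ζ
      have one : ∀ k : ℕ, (1:ℝ≥0∞) ≤ (2:ℝ≥0∞)^(((k:ℝ)+1)*t) := fun k =>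
        by
        exact dso_one_le_rpow (by norm_num) (by positivity)
      rcases lt_or_ge 1 ‖ζ - z‖ with h | h
      · refine le_add_right ?_
        rw [ENNReal.rpow_neg, ENNReal.inv_le_one]
        refine dso_one_le_rpow ?_ ht
        rw [← ofReal_norm, ENNReal.one_le_ofReal]
        exact h.le
      · rcases eq_or_lt_of_le (norm_nonneg (ζ - z)) with h0 | h0
        · refine le_add_left ?_
          have : ζ = z := by simpa [sub_eq_zero] using h0.symm
          subst this
          refine le_trans le_top ?_
          rw [← ENNReal.tsum_const_eq_top_of_ne_zero (α := ℕ) (c := 1) (by simp)]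
          refine ENNReal.tsum_le_tsum fun k => ?_
          rw [Set.indicator_of_mem (by simp)]
          exact one k
        · obtain ⟨k, hk1, hk2⟩ := exists_nat_pow_near_of_lt_one h0 h (by norm_num : (0:ℝ) < 1/2) (by norm_num)
          refine le_add_left (le_trans ?_ (ENNReal.le_tsum k))
          rw [Set.indicator_of_mem (by simpa [dist_eq_norm] using hk2)]
          have h1 : (2:ℝ≥0∞) ^ (-((k+1:ℕ):ℝ)) ≤ ‖ζ - z‖ₑ := by
            rw [← dso_half_pow, ← ofReal_norm]
            exact ENNReal.ofReal_le_ofReal hk1.le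
          calc ‖ζ - z‖ₑ ^ (-t) ≤ ((2:ℝ≥0∞) ^ (-((k+1:ℕ):ℝ))) ^ (-t) :=
                dso_rpow_anti ht h1
            _ = _ := by rw [← ENNReal.rpow_mul]; congr 1; push_cast; ring
    calc ∫⁻ ζ, ‖ζ - z‖ₑ ^ (-t) ∂m ≤ ∫⁻ ζ, (1 + ∑' k : ℕ,
        (closedBall z ((1/2:ℝ)^k)).indicator (fun _ => (2:ℝ≥0∞)^(((k:ℝ)+1)*t)) ζ) ∂m := lintegral_mono key
      _ = m Set.univ + ∑' k : ℕ, (2:ℝ≥0∞)^(((k:ℝ)+1)*t) * m (closedBall z ((1/2:ℝ)^k)) := by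
        rw [lintegral_add_left measurable_const, lintegral_tsum]
        · simp only [lintegral_const, one_mul]
          congr 2; ext k
          rw [lintegral_indicator measurableSet_closedBall]; simp
        · intro k
          exact (measurable_const.indicator measurableSet_closedBall).aemeasurable
      _ ≤ _ := by
        refine add_le_add le_rfl (ENNReal.tsum_le_tsum fun k => ?_)
        calc (2:ℝ≥0∞)^(((k:ℝ)+1)*t) * m (closedBall z ((1/2:ℝ)^k))
            ≤ (2:ℝ≥0∞)^(((k:ℝ)+1)*t) * (C * ENNReal.ofReal ((1/2:ℝ)^k) ^ s) := by
              gcongr; exact hg z _ (by positivity)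
          _ = C * ((2:ℝ≥0∞)^(((k:ℝ)+1)*t) * (2:ℝ≥0∞)^(-(k:ℝ)*s)) := by
              rw [dso_half_pow, ← ENNReal.rpow_mul]; ring
          _ = C * ((2:ℝ≥0∞)^t * (2:ℝ≥0∞)^(-(s-t)*(k:ℝ))) := by
              rw [← ENNReal.rpow_add _ _ (by simp) (by simp), ← ENNReal.rpow_add _ _ (by simp) (by simp)]
              congr 2; ring_nf
          _ = _ := by
              rw [ENNReal.rpow_mul, ENNReal.rpow_natCast]; ring

/-- Schur-type estimate. -/
lemma dso_schur {Z Y : Type*} [MeasurableSpace Z] [MeasurableSpace Y] (μ : Measure Z) (m : Measure Y)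
    [SFinite μ] [SFinite m]
    (K k₂ : Z → Y → ℝ≥0∞) (hk₂ : Measurable (Function.uncurry k₂))
    (r q : ℝ) (hr : 0 < r) (hrq : r ≤ q) (A B : ℝ≥0∞)
    (hB : ∀ y, ∫⁻ z, k₂ z y ^ q ∂μ ≤ B)
    (F : Y → ℝ≥0∞) (hF : Measurable F)
    (hA : ∀ z, ∫⁻ y, K z y * F y ∂m ≤ A * (∫⁻ y, (k₂ z y * F y) ^ r ∂m) ^ (1 / r)) :
    ∫⁻ z, (∫⁻ y, K z y * F y ∂m) ^ q ∂μ ≤ A ^ q * B * (∫⁻ y, F y ^ r ∂m) ^ (q / r) := by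
  have hq : 0 < q := lt_of_lt_of_le hr hrq
  set N := ∫⁻ y, F y ^ r ∂m with hN
  have hFr : Measurable fun y => F y ^ r := hF.pow_const r
  have step : ∀ z, (∫⁻ y, K z y * F y ∂m) ^ q ≤
      A ^ q * (N ^ (q / r - 1) * ∫⁻ y, F y ^ r * k₂ z y ^ q ∂m) := by
    intro z
    have hkz : Measurable (k₂ z) := hk₂.comp measurable_prodMk_left
    refine (ENNReal.rpow_le_rpow (hA z) hq.le).trans ?_
    rw [ENNReal.mul_rpow_of_nonneg _ _ hq.le]
    gcongr
    have h := eLpNorm'_le_eLpNorm'_mul_rpow_measure_univ (μ := m.withDensity fun y => F y ^ r)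
      hr hrq hkz.aestronglyMeasurable
    simp only [eLpNorm', enorm_eq_self] at h
    rw [lintegral_withDensity_eq_lintegral_mul _ hFr (hkz.pow_const _),
      lintegral_withDensity_eq_lintegral_mul _ hFr (hkz.pow_const _),
      withDensity_apply _ MeasurableSet.univ, setLIntegral_univ] at h
    have h' := ENNReal.rpow_le_rpow h hq.le
    rw [ENNReal.mul_rpow_of_nonneg _ _ hq.le, ← ENNReal.rpow_mul, ← ENNReal.rpow_mul, ← ENNReal.rpow_mul] at h'
    rw [← ENNReal.rpow_mul]
    have e1 : (1 / q * q) = 1 := by field_simp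
    have e2 : (1 / r - 1 / q) * q = q / r - 1 := by field_simp
    rw [e1, e2, ENNReal.rpow_one] at h'
    simp only [Pi.mul_apply] at h'
    rw [mul_comm (N ^ _)]
    refine le_trans (le_of_eq ?_) h'
    congr 2
    ext y
    rw [ENNReal.mul_rpow_of_nonneg _ _ hr.le, mul_comm]
  have hm : Measurable fun p : Z × Y => F p.2 ^ r * k₂ p.1 p.2 ^ q :=
    (hFr.comp measurable_snd).mul (hk₂.pow_const q)
  calc ∫⁻ z, (∫⁻ y, K z y * F y ∂m) ^ q ∂μ
      ≤ ∫⁻ z, A ^ q * (N ^ (q / r - 1) * ∫⁻ y, F y ^ r * k₂ z y ^ q ∂m) ∂μ := lintegral_mono step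
    _ = A ^ q * (N ^ (q / r - 1) * ∫⁻ z, ∫⁻ y, F y ^ r * k₂ z y ^ q ∂m ∂μ) := by
      have h1 : Measurable fun z => ∫⁻ y, F y ^ r * k₂ z y ^ q ∂m := hm.lintegral_prod_right'
      rw [lintegral_const_mul _ (h1.const_mul _), lintegral_const_mul _ h1]
    _ = A ^ q * (N ^ (q / r - 1) * ∫⁻ y, F y ^ r * ∫⁻ z, k₂ z y ^ q ∂μ ∂m) := by
      rw [lintegral_lintegral_swap hm.aemeasurable]
      congr 3
      ext y
      rw [lintegral_const_mul]
      exact (hk₂.comp measurable_prodMk_right).pow_const q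
    _ ≤ A ^ q * (N ^ (q / r - 1) * ∫⁻ y, F y ^ r * B ∂m) := by
      gcongr with y
      exact hB y
    _ = A ^ q * B * (N ^ (q / r - 1) * N) := by
      rw [lintegral_mul_const _ hFr]; ring
    _ ≤ _ := by
      gcongr
      have : q / r = (q / r - 1) + 1 := by ring
      rcases eq_or_ne N 0 with h | h
      · simp [h]
      · rcases eq_or_ne N ∞ with h' | h'
        · rw [h', ENNReal.top_rpow_of_pos (div_pos hq hr)]; exact le_top
        · conv_rhs => rw [this, ENNReal.rpow_add _ _ h h', ENNReal.rpow_one]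

/-- Weighted estimate for the fractional kernel, in the case `r ≤ q`. -/
lemma dso_kernel_le {E : Type*} [NormedAddCommGroup E] [MeasurableSpace E] [BorelSpace E]
    [SecondCountableTopology E]
    (μ m : Measure E) [IsFiniteMeasure μ] [IsFiniteMeasure m] (C C' : ℝ≥0∞) (hC : C ≠ ∞) (hC' : C' ≠ ∞)
    (d s κ q r : ℝ) (hκ : 0 < κ) (hd : κ < d) (hs : κ ≤ s) (hr : 1 ≤ r) (hrq : r ≤ q)
    (hcond : κ - s * (1 - 1 / r) < d / q)
    (hμ : ∀ z : E, ∀ ρ : ℝ, 0 < ρ → μ (closedBall z ρ) ≤ C * ENNReal.ofReal ρ ^ d)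
    (hm : ∀ z : E, ∀ ρ : ℝ, 0 < ρ → m (closedBall z ρ) ≤ C' * ENNReal.ofReal ρ ^ s) :
    ∃ A : ℝ≥0∞, A ≠ ∞ ∧ ∀ F : E → ℝ≥0∞, Measurable F →
      ∫⁻ z, (∫⁻ y, ‖y - z‖ₑ ^ (-κ) * F y ∂m) ^ q ∂μ ≤ A * (∫⁻ y, F y ^ r ∂m) ^ (q / r) := by
  have hr0 : 0 < r := by linarith
  have hq0 : 0 < q := by linarith
  have hmeas : ∀ t : ℝ, Measurable (Function.uncurry fun z y : E => ‖y - z‖ₑ ^ t) := fun t =>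
    ((measurable_snd.sub measurable_fst).enorm).pow_const t
  -- choose the exponent `a` for the second factor
  obtain ⟨a, ha0, ha1, ha2, ha3⟩ : ∃ a : ℝ, 0 ≤ a ∧ a ≤ κ ∧ a * q < d ∧
      ((r = 1 ∧ a = κ) ∨ (1 < r ∧ (κ - a) * (r / (r - 1)) < s)) := by
    rcases eq_or_lt_of_le hr with h | h
    · refine ⟨κ, hκ.le, le_rfl, ?_, Or.inl ⟨h.symm, rfl⟩⟩
      rw [← h] at hcond
      have : κ < d / q := by simpa using hcond
      rwa [lt_div_iff₀ hq0] at this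
    · have hdq : 0 < d / q := by have : 0 < d := by linarith
                                 positivity
      have hpos : 0 < s * (1 - 1 / r) := by
        have : 0 < 1 - 1 / r := by rw [sub_pos, div_lt_one hr0]; exact h
        have : 0 < s := by linarith
        positivity
      obtain ⟨a, h1, h2⟩ := exists_between (show max 0 (κ - s * (1 - 1 / r)) < min κ (d / q) by
        rw [max_lt_iff, lt_min_iff, lt_min_iff]
        exact ⟨⟨hκ, hdq⟩, by linarith, hcond⟩)
      rw [max_lt_iff] at h1
      rw [lt_min_iff] at h2
      refine ⟨a, h1.1.le, h2.1.le, ?_, Or.inr ⟨h, ?_⟩⟩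
      · have := h2.2
        rwa [lt_div_iff₀ hq0] at this
      · have h3 : κ - a < s * (1 - 1 / r) := by linarith [h1.2]
        have : 0 < r - 1 := by linarith
        rw [← lt_div_iff₀ (by positivity)]
        have e : s / (r / (r - 1)) = s * (1 - 1 / r) := by
          field_simp
        rw [e]; exact h3
  obtain ⟨B, hB, hB'⟩ := dso_riesz μ C hC d (a * q) (by positivity) ha2 hμ
  have hBq : ∀ y, ∫⁻ z, (‖y - z‖ₑ ^ (-a)) ^ q ∂μ ≤ B := by
    intro y
    refine le_trans (le_of_eq ?_) (hB' y)
    congr 1; ext z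
    rw [← ENNReal.rpow_mul, enorm_sub_rev]; ring_nf
  obtain ⟨A, hA, hA'⟩ : ∃ A : ℝ≥0∞, A ≠ ∞ ∧ ∀ F : E → ℝ≥0∞, Measurable F → ∀ z,
      ∫⁻ y, ‖y - z‖ₑ ^ (-κ) * F y ∂m ≤ A * (∫⁻ y, (‖y - z‖ₑ ^ (-a) * F y) ^ r ∂m) ^ (1 / r) := by
    rcases ha3 with ⟨h1, h2⟩ | ⟨h1, h2⟩
    · refine ⟨1, by simp, fun F hF z => ?_⟩
      subst h1 h2
      simp
    · have hconj : r.HolderConjugate (r / (r - 1)) := Real.HolderConjugate.conjExponent h1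
      have hr' : 0 < r / (r - 1) := by
        have : 0 < r - 1 := by linarith
        positivity
      obtain ⟨A, hA, hA'⟩ := dso_riesz m C' hC' s ((κ - a) * (r / (r - 1)))
        (mul_nonneg (by linarith) hr'.le) h2 hm
      refine ⟨A ^ (1 / (r / (r - 1))), ENNReal.rpow_ne_top_of_nonneg (by positivity) hA, fun F hF z => ?_⟩
      have hm1 : ∀ t : ℝ, Measurable fun y : E => ‖y - z‖ₑ ^ t := fun t => (hmeas t).comp measurable_prodMk_left
      have hold := ENNReal.lintegral_mul_le_Lp_mul_Lq m hconj
        (((hm1 (-a)).mul hF).aemeasurable) ((hm1 (-(κ - a))).aemeasurable)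
      calc ∫⁻ y, ‖y - z‖ₑ ^ (-κ) * F y ∂m ≤ _ := by
            refine le_trans (lintegral_mono fun y => ?_) hold
            simp only [Pi.mul_apply]
            rcases eq_or_ne (‖y - z‖ₑ) 0 with h | h
            · rcases eq_or_lt_of_le ha0 with h0 | h0
              · subst h0; simp [mul_comm]
              · rcases eq_or_lt_of_le ha1 with h3 | h3
                · subst h3; simp
                · rw [h, ENNReal.zero_rpow_of_neg (by linarith), ENNReal.zero_rpow_of_neg (by linarith),
                    ENNReal.zero_rpow_of_neg (by linarith)]
                  rcases eq_or_ne (F y) 0 with h5 | h5 <;> simp [h5]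
            · have : (-κ) = (-a) + (-(κ - a)) := by ring
              rw [this, ENNReal.rpow_add _ _ h (by simp)]
              refine le_of_eq ?_
              ring
        _ ≤ _ := by
            rw [mul_comm]
            refine mul_le_mul' (ENNReal.rpow_le_rpow ?_ (by positivity)) le_rfl
            refine le_trans (le_of_eq ?_) (hA' z)
            congr 1; ext y
            rw [← ENNReal.rpow_mul]; ring_nf
  refine ⟨A ^ q * B, ENNReal.mul_ne_top (ENNReal.rpow_ne_top_of_nonneg hq0.le hA) hB, fun F hF => ?_⟩
  exact dso_schur μ m _ (fun z y => ‖y - z‖ₑ ^ (-a)) (hmeas (-a)) r q hr0 hrq A B hBq F hF (hA' F hF)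

/-- General case, as an inequality of norms. -/
lemma dso_kernel {E : Type*} [NormedAddCommGroup E] [MeasurableSpace E] [BorelSpace E]
    [SecondCountableTopology E]
    (μ m : Measure E) [IsFiniteMeasure μ] [IsFiniteMeasure m] (C C' : ℝ≥0∞) (hC : C ≠ ∞) (hC' : C' ≠ ∞)
    (d s κ q r : ℝ) (hκ : 0 < κ) (hd : κ < d) (hs : κ ≤ s) (hsd : s ≤ d) (hr : 1 ≤ r) (hq : 1 ≤ q)
    (hcond : κ - s * (1 - 1 / r) < d / q)
    (hμ : ∀ z : E, ∀ ρ : ℝ, 0 < ρ → μ (closedBall z ρ) ≤ C * ENNReal.ofReal ρ ^ d)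
    (hm : ∀ z : E, ∀ ρ : ℝ, 0 < ρ → m (closedBall z ρ) ≤ C' * ENNReal.ofReal ρ ^ s) :
    ∃ A : ℝ≥0∞, A ≠ ∞ ∧ ∀ F : E → ℝ≥0∞, Measurable F →
      (∫⁻ z, (∫⁻ y, ‖y - z‖ₑ ^ (-κ) * F y ∂m) ^ q ∂μ) ^ (1 / q) ≤ A * (∫⁻ y, F y ^ r ∂m) ^ (1 / r) := by
  have hr0 : 0 < r := by linarith
  have hq0 : 0 < q := by linarith
  have main : ∀ q : ℝ, r ≤ q → κ - s * (1 - 1 / r) < d / q → ∃ A : ℝ≥0∞, A ≠ ∞ ∧ ∀ F : E → ℝ≥0∞, Measurable F →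
      (∫⁻ z, (∫⁻ y, ‖y - z‖ₑ ^ (-κ) * F y ∂m) ^ q ∂μ) ^ (1 / q) ≤ A * (∫⁻ y, F y ^ r ∂m) ^ (1 / r) := by
    intro q hrq hcond
    have hq0 : 0 < q := by linarith
    obtain ⟨A, hA, h⟩ := dso_kernel_le μ m C C' hC hC' d s κ q r hκ hd hs hr hrq hcond hμ hm
    refine ⟨A ^ (1 / q), ENNReal.rpow_ne_top_of_nonneg (by positivity) hA, fun F hF => ?_⟩
    refine (ENNReal.rpow_le_rpow (h F hF) (by positivity)).trans (le_of_eq ?_)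
    rw [ENNReal.mul_rpow_of_nonneg _ _ (by positivity), ← ENNReal.rpow_mul]
    congr 2; field_simp
  rcases le_total r q with h | h
  · exact main q h hcond
  · obtain ⟨A, hA, hF⟩ := main r le_rfl (by
      have : 0 < (s - κ) * r + (d - s) := by
        rcases eq_or_lt_of_le hs with h | h
        · subst h; linarith
        · have : 0 < (s - κ) * r := by have : 0 < s - κ := by linarith
                                       positivity
          linarith
      rw [lt_div_iff₀ hr0]
      have e : (κ - s * (1 - 1 / r)) * r = κ * r - s * r + s := by field_simp; ring
      rw [e]; linarith)
    refine ⟨A * μ Set.univ ^ (1 / q - 1 / r), ENNReal.mul_ne_top hA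
      (ENNReal.rpow_ne_top_of_nonneg (sub_nonneg.2 (one_div_le_one_div_of_le hq0 h)) (measure_ne_top _ _)),
      fun F hFm => ?_⟩
    have hmeas : Measurable fun z => ∫⁻ y, ‖y - z‖ₑ ^ (-κ) * F y ∂m := by
      refine Measurable.lintegral_prod_right' (f := fun p : E × E => ‖p.2 - p.1‖ₑ ^ (-κ) * F p.2) ?_
      exact (((measurable_snd.sub measurable_fst).enorm).pow_const _).mul (hFm.comp measurable_snd)
    have h1 := eLpNorm'_le_eLpNorm'_mul_rpow_measure_univ (μ := μ) hq0 h hmeas.aestronglyMeasurable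
    simp only [eLpNorm', enorm_eq_self] at h1
    refine h1.trans ?_
    calc _ ≤ A * (∫⁻ y, F y ^ r ∂m) ^ (1 / r) * μ Set.univ ^ (1 / q - 1 / r) := by
          gcongr; exact hF F hFm
      _ = _ := by ring
end

section

section dsoSphere
set_option linter.unusedSectionVars false
variable {E : Type*} [NormedAddCommGroup E] [InnerProductSpace ℝ E] [FiniteDimensional ℝ E]
  [MeasurableSpace E] [BorelSpace E]

/-- Finite Hausdorff measure of spheres. -/
lemma dso_sphere_finite (k : ℕ) (hk : Module.finrank ℝ E = k + 1) (R : ℝ) (hR : 0 < R) :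
    μH[(k : ℝ)] (sphere (0 : E) R) < ∞ := by
  have : Fact (Module.finrank ℝ E = k + 1) := ⟨hk⟩
  have : Nontrivial E := Module.nontrivial_of_finrank_pos (R := ℝ) (by omega)
  have cap : ∀ v : E, ‖v‖ = 1 →
      μH[(k : ℝ)] ((fun w : (Submodule.span ℝ {v})ᗮ => R • stereoInvFunAux v (w : E)) '' closedBall 0 2) < ∞ := by
    intro v hv
    have hc : ContDiff ℝ 1 (fun w : (Submodule.span ℝ {v})ᗮ => R • stereoInvFunAux v (w : E)) :=
      contDiff_const.smul (contDiff_stereoInvFunAux.comp (Submodule.span ℝ {v})ᗮ.subtypeL.contDiff)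
    obtain ⟨K, hK⟩ := LocallyLipschitzOn.exists_lipschitzOnWith_of_compact
      (isCompact_closedBall (0 : (Submodule.span ℝ {v})ᗮ) 2) hc.locallyLipschitz.locallyLipschitzOn
    refine (hK.hausdorffMeasure_image_le (d := k) (by positivity)).trans_lt ?_
    have hf : Module.finrank ℝ (Submodule.span ℝ {v})ᗮ = k :=
      Submodule.finrank_orthogonal_span_singleton (by intro h; simp [h] at hv)
    have hH : (μH[(k:ℝ)] : Measure (Submodule.span ℝ {v})ᗮ).IsAddHaarMeasure := by
      have := isAddHaarMeasure_hausdorffMeasure (E := (Submodule.span ℝ {v})ᗮ)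
      rwa [hf] at this
    refine ENNReal.mul_lt_top ?_ (isCompact_closedBall _ _).measure_lt_top
    exact ENNReal.rpow_lt_top_of_nonneg (by positivity) (by simp)
  obtain ⟨v, hv⟩ := exists_norm_eq E (zero_le_one' ℝ)
  have mem : ∀ v : E, ‖v‖ = 1 → ∀ x ∈ sphere (0:E) R, inner ℝ v x ≤ 0 →
      x ∈ (fun w : (Submodule.span ℝ {v})ᗮ => R • stereoInvFunAux v (w : E)) '' closedBall 0 2 := by
    intro v hv x hx hvx
    have hx' : ‖x‖ = R := by simpa using hx
    let y : sphere (0:E) 1 := ⟨R⁻¹ • x, by simp [norm_smul, hx', abs_of_pos hR, hR.ne']⟩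
    have hy : inner ℝ v (y : E) ≤ 0 := by
      simp only [y, inner_smul_right]
      exact mul_nonpos_of_nonneg_of_nonpos (by positivity) hvx
    have hyv : (y : E) ≠ v := by
      intro h
      rw [h, real_inner_self_eq_norm_sq, hv] at hy
      norm_num at hy
    refine ⟨stereoToFun v (y : E), ?_, ?_⟩
    · rw [mem_closedBall_zero_iff, stereoToFun_apply, norm_smul]
      have h1 : ‖(Submodule.span ℝ {v})ᗮ.orthogonalProjectionOnto (y : E)‖ ≤ 1 := by
        refine (Submodule.norm_orthogonalProjectionOnto_apply_le _ _).trans ?_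
        simp
      have h2 : ‖2 / ((1:ℝ) - innerSL ℝ v (y:E))‖ ≤ 2 := by
        rw [innerSL_apply_apply, Real.norm_eq_abs, abs_of_pos (by apply div_pos two_pos; linarith)]
        exact div_le_self (by norm_num) (by linarith)
      calc _ ≤ (2:ℝ) * 1 := mul_le_mul h2 h1 (norm_nonneg _) (by norm_num)
        _ = 2 := by norm_num
    · have := congrArg Subtype.val (stereo_left_inv hv hyv)
      change R • (stereoInvFun hv (stereoToFun v (y:E)) : E) = x
      rw [this]
      simp [y, smul_smul, hR.ne']
  refine (measure_mono (t := _ ∪ _) ?_).trans_lt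
    (measure_union_lt_top (cap v hv) (cap (-v) (by simpa using hv)))
  intro x hx
  rcases le_total (inner ℝ v x) 0 with h | h
  · exact Or.inl (mem v hv x hx h)
  · exact Or.inr (mem (-v) (by simpa using hv) x hx (by rw [inner_neg_left]; linarith))

/-- Radial projection onto the sphere of radius `R`. -/
noncomputable def dsoProj (R : ℝ) (w : E) : E := (R / ‖w‖) • w

/-- The cone measure on the sphere of radius `R`. -/
noncomputable def dsoSigma (R : ℝ) : Measure E := (volume.restrict (ball (0:E) R)).map (dsoProj R)

lemma dso_proj_measurable [SecondCountableTopology E] (R : ℝ) : Measurable (dsoProj R : E → E) :=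
  (measurable_const.div measurable_norm).smul measurable_id

instance (R : ℝ) : IsFiniteMeasure (dsoSigma R : Measure E) := by
  have : IsFiniteMeasure ((volume : Measure E).restrict (ball (0:E) R)) :=
    ⟨by rw [Measure.restrict_apply_univ]; exact measure_ball_lt_top⟩
  unfold dsoSigma; infer_instance

lemma dso_proj_eq (R : ℝ) (hR : 0 < R) (w : E) : w = (‖w‖ / R) • dsoProj R w := by
  rcases eq_or_ne w 0 with h | h
  · simp [h]
  · have : ‖w‖ ≠ 0 := norm_ne_zero_iff.2 h
    rw [dsoProj, smul_smul]
    field_simp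
    simp

lemma dso_proj_norm (R : ℝ) (hR : 0 < R) (w : E) (hw : w ≠ 0) : ‖dsoProj R w‖ = R := by
  have : ‖w‖ ≠ 0 := norm_ne_zero_iff.2 hw
  rw [dsoProj, norm_smul, Real.norm_eq_abs, abs_of_nonneg (by positivity)]
  field_simp

lemma dso_sigma_growth (k : ℕ) (hk : Module.finrank ℝ E = k + 1) (hk1 : 1 ≤ k) (R : ℝ) (hR : 0 < R) :
    ∃ C : ℝ≥0∞, C ≠ ∞ ∧ 1 ≤ C ∧ ∀ z : E, ∀ ρ : ℝ, 0 < ρ →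
      dsoSigma R (closedBall z ρ) ≤ C * ENNReal.ofReal ρ ^ (k : ℝ) := by
  have : Nontrivial E := Module.nontrivial_of_finrank_pos (R := ℝ) (by omega)
  set V := (volume : Measure E) (ball 0 1) with hV
  have hVt : V ≠ ∞ := measure_ball_lt_top.ne
  refine ⟨1 + (V * ENNReal.ofReal R + ENNReal.ofReal (2 * R * 3 ^ (k+1)) * V), ?_, le_self_add, ?_⟩
  · simp [ENNReal.mul_eq_top, hVt]
  intro z ρ hρ
  rw [dsoSigma, Measure.map_apply (dso_proj_measurable R) measurableSet_closedBall,
    Measure.restrict_apply (dso_proj_measurable R measurableSet_closedBall)]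
  refine le_trans ?_ (mul_le_mul_left (le_add_self) _)
  rw [ENNReal.rpow_natCast, ← ENNReal.ofReal_pow hρ.le]
  rcases lt_or_ge R ρ with hRρ | hRρ
  · calc _ ≤ volume (ball (0:E) R) := measure_mono Set.inter_subset_right
      _ = V * ENNReal.ofReal R * ENNReal.ofReal (R ^ k) := by
        rw [Measure.addHaar_ball _ _ hR.le, hk, pow_succ, ENNReal.ofReal_mul (by positivity)]; ring
      _ ≤ _ := by
        gcongr
        exact le_self_add
  · rcases lt_or_ge (2 * R) ‖z‖ with hz | hz
    · have hsub : (dsoProj R ⁻¹' closedBall z ρ ∩ ball (0:E) R) ⊆ {0} := by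
        rintro w ⟨hw1, hw2⟩
        by_contra hne
        rw [Set.mem_preimage, mem_closedBall, dist_eq_norm] at hw1
        have h1 := dso_proj_norm R hR w hne
        have h2 := norm_sub_norm_le z (dsoProj R w)
        rw [norm_sub_rev] at h2
        linarith
      refine (measure_mono hsub).trans ?_
      rw [measure_singleton]
      exact zero_le
    · have hsub : (dsoProj R ⁻¹' closedBall z ρ ∩ ball (0:E) R) ⊆
          ⋃ j ∈ Finset.range (⌊R / ρ⌋₊ + 1), closedBall (((j:ℝ) * (ρ / R)) • z) (3 * ρ) := by
        rintro w ⟨hw1, hw2⟩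
        rw [Set.mem_preimage, mem_closedBall, dist_eq_norm] at hw1
        rw [mem_ball_zero_iff] at hw2
        set τ := ‖w‖ / R with hτ
        have hτ0 : 0 ≤ τ := by positivity
        have hτ1 : τ ≤ 1 := by rw [hτ, div_le_one hR]; exact hw2.le
        set j := ⌊τ * R / ρ⌋₊ with hj
        have hj1 : (j:ℝ) ≤ τ * R / ρ := Nat.floor_le (by positivity)
        have hj2 : τ * R / ρ < j + 1 := Nat.lt_floor_add_one _
        simp only [Set.mem_iUnion, Finset.mem_range]
        refine ⟨j, ?_, ?_⟩
        · rw [Nat.lt_succ_iff]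
          refine Nat.floor_le_floor ?_
          gcongr
          nlinarith
        · rw [mem_closedBall, dist_eq_norm]
          have hw : w = τ • dsoProj R w := dso_proj_eq R hR w
          have e : w - ((j:ℝ) * (ρ / R)) • z = τ • (dsoProj R w - z) + (τ - j * (ρ / R)) • z := by
            rw [smul_sub, ← hw, sub_smul]; abel
          rw [e]
          have h1 : ‖τ • (dsoProj R w - z)‖ ≤ ρ := by
            rw [norm_smul, Real.norm_eq_abs, abs_of_nonneg hτ0]
            nlinarith [norm_nonneg (dsoProj R w - z)]
          have h2 : |τ - j * (ρ / R)| ≤ ρ / R := by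
            rw [le_div_iff₀ hρ] at hj1
            rw [div_lt_iff₀ hρ] at hj2
            rw [abs_le]
            have : j * (ρ / R) = j * ρ / R := by ring
            rw [this]
            constructor
            · have : j * ρ / R ≤ τ := by rw [div_le_iff₀ hR]; exact hj1
              have : 0 < ρ / R := by positivity
              linarith
            · have : τ ≤ (j+1) * ρ / R := by rw [le_div_iff₀ hR]; exact hj2.le
              have e : (j+1) * ρ / R = j * ρ / R + ρ / R := by ring
              linarith
          have h3 : ‖(τ - j * (ρ / R)) • z‖ ≤ 2 * ρ := by
            rw [norm_smul, Real.norm_eq_abs]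
            calc _ ≤ (ρ / R) * (2 * R) := by gcongr
              _ = 2 * ρ := by field_simp
          linarith [norm_add_le (τ • (dsoProj R w - z)) ((τ - j * (ρ / R)) • z)]
      calc _ ≤ _ := measure_mono hsub
        _ ≤ ∑ j ∈ Finset.range (⌊R / ρ⌋₊ + 1), volume (closedBall (((j:ℝ) * (ρ / R)) • z) (3 * ρ)) :=
          measure_biUnion_finset_le _ _
        _ = (⌊R / ρ⌋₊ + 1 : ℕ) * (ENNReal.ofReal ((3 * ρ) ^ (k+1)) * V) := by
          simp [Measure.addHaar_closedBall _ _ (show 0 ≤ 3 * ρ by positivity), hk]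
          rfl
        _ ≤ ENNReal.ofReal (2 * R / ρ) * (ENNReal.ofReal ((3 * ρ) ^ (k+1)) * V) := by
          gcongr
          rw [← ENNReal.ofReal_natCast]
          apply ENNReal.ofReal_le_ofReal
          push_cast
          have h1 : (⌊R / ρ⌋₊ : ℝ) ≤ R / ρ := Nat.floor_le (by positivity)
          have h2 : 1 ≤ R / ρ := by rw [le_div_iff₀ hρ]; linarith
          have : 2 * R / ρ = R / ρ + R / ρ := by ring
          linarith
        _ = ENNReal.ofReal (2 * R * 3 ^ (k+1)) * V * ENNReal.ofReal (ρ ^ k) := by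
          rw [← mul_assoc, ← ENNReal.ofReal_mul (by positivity), mul_right_comm, ← ENNReal.ofReal_mul (by positivity)]
          congr 2
          rw [mul_pow]
          field_simp
          ring
        _ ≤ _ := by gcongr; exact le_add_self

lemma dso_sigma_sphere (k : ℕ) (hk : Module.finrank ℝ E = k + 1) (R : ℝ) (hR : 0 < R) :
    (dsoSigma R : Measure E).restrict (sphere 0 R) = dsoSigma R := by
  have : Nontrivial E := Module.nontrivial_of_finrank_pos (R := ℝ) (by omega)
  refine Measure.restrict_eq_self_of_ae_mem ?_
  rw [dsoSigma]
  refine (ae_map_iff (p := fun x : E => x ∈ sphere (0:E) R) (dso_proj_measurable R).aemeasurable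
    isClosed_sphere.measurableSet).2 ?_
  refine ae_restrict_of_ae ?_
  have : ∀ᵐ w : E, w ≠ 0 := by
    rw [ae_iff]; simp
  filter_upwards [this] with w hw
  simp [dso_proj_norm R hR w hw]

lemma dso_sigma_le_hausdorff (k : ℕ) (hk : Module.finrank ℝ E = k + 1) (hk1 : 1 ≤ k) (R : ℝ) (hR : 0 < R) :
    ∃ C : ℝ≥0∞, C ≠ ∞ ∧ (dsoSigma R : Measure E) ≤ C • (μH[(k:ℝ)]).restrict (sphere (0:E) R) := by
  obtain ⟨C, hC, hC1, h⟩ := dso_sigma_growth (E := E) k hk hk1 R hR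
  have hC0 : C ≠ 0 := (lt_of_lt_of_le one_pos hC1).ne'
  have hk0 : (0:ℝ) < k := by exact_mod_cast hk1
  refine ⟨C, hC, ?_⟩
  have key : C⁻¹ • (dsoSigma R : Measure E) ≤ μH[(k:ℝ)] := by
    refine Measure.le_hausdorffMeasure _ _ 1 one_pos fun s hs => ?_
    rw [Measure.smul_apply, smul_eq_mul, ENNReal.inv_mul_le_iff hC0 hC]
    rcases s.eq_empty_or_nonempty with rfl | ⟨a, ha⟩
    · simp
    have hfin : ediam s ≠ ∞ := (hs.trans_lt ENNReal.one_lt_top).ne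
    have hall : ∀ ρ : ℝ, diam s < ρ → dsoSigma R s ≤ C * ENNReal.ofReal ρ ^ (k:ℝ) := by
      intro ρ hρ
      refine (measure_mono fun x hx => ?_).trans (h a ρ (diam_nonneg.trans_lt hρ))
      rw [mem_closedBall]
      exact (dist_le_diam_of_mem' hfin hx ha).trans hρ.le
    have hcont : Continuous fun ρ : ℝ => C * ENNReal.ofReal ρ ^ (k:ℝ) :=
      (ENNReal.continuous_const_mul hC).comp
        ((ENNReal.continuous_rpow_const).comp ENNReal.continuous_ofReal)
    have hlim := ge_of_tendsto ((hcont.tendsto (diam s)).mono_left nhdsWithin_le_nhds)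
      (eventually_mem_nhdsWithin (s := Set.Ioi (diam s)) |>.mono fun ρ hρ => hall ρ hρ)
    rwa [diam, ENNReal.ofReal_toReal hfin] at hlim
  have h2 : (dsoSigma R : Measure E) ≤ C • μH[(k:ℝ)] := by
    intro s
    have := key s
    rwa [Measure.smul_apply, smul_eq_mul, ENNReal.inv_mul_le_iff hC0 hC] at this
  rw [← dso_sigma_sphere k hk R hR, ← Measure.restrict_smul]
  exact Measure.restrict_mono le_rfl h2

open scoped Pointwise in
lemma dso_shell (k : ℕ) (hk : Module.finrank ℝ E = k + 1) (R a : ℝ) (ha : 0 < a) (haR : a ≤ R)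
    (h : E → ℝ≥0∞) (hh : Measurable h) :
    ∫⁻ w in ball (0:E) R \ ball 0 a, h (dsoProj R w)
      = ENNReal.ofReal (1 - (a / R) ^ (k+1)) * ∫⁻ w, h w ∂(dsoSigma R) := by
  have hR : 0 < R := ha.trans_le haR
  have hm : ((volume : Measure E).restrict (ball (0:E) R \ ball 0 a)).map (dsoProj R) =
      ENNReal.ofReal (1 - (a / R) ^ (k+1)) • dsoSigma R := by
    ext A hA
    have hT := dso_proj_measurable (E := E) R hA
    rw [Measure.map_apply (dso_proj_measurable R) hA, Measure.restrict_apply hT,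
      Measure.smul_apply, dsoSigma, Measure.map_apply (dso_proj_measurable R) hA, Measure.restrict_apply hT]
    set T := (dsoProj R : E → E) ⁻¹' A with hTd
    have e1 : T ∩ ball 0 a = (a / R) • (T ∩ ball 0 R) := by
      have hc : 0 < a / R := by positivity
      ext w
      rw [Set.mem_smul_set_iff_inv_smul_mem₀ hc.ne']
      have p1 : dsoProj R ((a / R)⁻¹ • w) = dsoProj R w := by
        rcases eq_or_ne w 0 with rfl | hw
        · simp
        have : ‖w‖ ≠ 0 := norm_ne_zero_iff.2 hw
        simp only [dsoProj, norm_smul, smul_smul, Real.norm_eq_abs, abs_of_pos (inv_pos.2 hc)]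
        congr 1
        field_simp
      simp only [Set.mem_inter_iff, hTd, Set.mem_preimage, p1, mem_ball_zero_iff, norm_smul,
        Real.norm_eq_abs, abs_of_pos (inv_pos.2 hc)]
      refine and_congr_right fun _ => ?_
      rw [inv_mul_lt_iff₀ hc]
      field_simp
    have e2 : T ∩ (ball 0 R \ ball 0 a) = (T ∩ ball 0 R) \ (T ∩ ball 0 a) := by
      ext w; simp only [Set.mem_inter_iff, Set.mem_sdiff]; tauto
    have hfin : volume (T ∩ ball 0 R) ≠ ∞ :=
      ((measure_mono Set.inter_subset_right).trans_lt measure_ball_lt_top).ne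
    rw [e2, measure_sdiff, e1, Measure.addHaar_smul, hk, abs_of_pos (by positivity),
      ENNReal.ofReal_sub _ (by positivity), smul_eq_mul, ENNReal.sub_mul (fun _ _ => hfin)]
    · simp
    · exact Set.inter_subset_inter_right _ (ball_subset_ball haR)
    · exact (hT.inter measurableSet_ball).nullMeasurableSet
    · exact ((measure_mono Set.inter_subset_right).trans_lt measure_ball_lt_top).ne
  rw [← lintegral_map hh (dso_proj_measurable R), hm, lintegral_smul_measure, smul_eq_mul]

end dsoSphere
end

/-- Regularised Bochner-Martinelli kernel. -/
noncomputable def dsoK (n : ℕ) (e : ℝ) (z : EuclideanSpace ℂ (Fin n)) (j : Fin n)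
    (ζ : EuclideanSpace ℂ (Fin n)) : ℂ :=
  (((‖ζ - z‖ ^ 2 + e ^ 2) ^ n)⁻¹ : ℝ) • (starRingEnd ℂ (ζ j - z j))

lemma dso_phi_deriv (n : ℕ) (e : ℝ) (he : 0 < e) (s : ℝ) (hs : 0 ≤ s) :
    HasDerivAt (fun s : ℝ => ((s + e ^ 2) ^ n)⁻¹) (-(n:ℝ) / (s + e ^ 2) ^ (n+1)) s := by
  have hp : 0 < s + e ^ 2 := by positivity
  have h1 : HasDerivAt (fun s : ℝ => (s + e ^ 2) ^ n) (n * (s + e ^ 2) ^ (n-1) * 1) s :=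
    ((hasDerivAt_id s).add_const (e ^ 2)).pow n
  have h2 := h1.inv (by positivity)
  convert! h2 using 1
  rcases n with _ | n
  · simp
  · simp only [Nat.add_sub_cancel]
    field_simp
    ring

lemma dsoK_hasFDerivAt (n : ℕ) (e : ℝ) (he : 0 < e) (z : EuclideanSpace ℂ (Fin n)) (j : Fin n)
    (ζ : EuclideanSpace ℂ (Fin n)) :
    ∃ L : EuclideanSpace ℂ (Fin n) →L[ℝ] ℂ, HasFDerivAt (dsoK n e z j) L ζ ∧
      ∀ v, L v = (((‖ζ - z‖ ^ 2 + e ^ 2) ^ n)⁻¹ : ℝ) • (starRingEnd ℂ (v j)) +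
        ((-(n:ℝ) / (‖ζ - z‖ ^ 2 + e ^ 2) ^ (n+1)) * (2 * inner ℝ (ζ - z) v)) • (starRingEnd ℂ (ζ j - z j)) := by
  have h1 : HasFDerivAt (fun ζ : EuclideanSpace ℂ (Fin n) => ‖ζ - z‖ ^ 2)
      (2 • (innerSL ℝ (ζ - z))) ζ := by
    have := (hasStrictFDerivAt_norm_sq (ζ - z)).hasFDerivAt.comp ζ ((hasFDerivAt_id ζ).sub_const z)
    convert! this using 1
  have h2 := (dso_phi_deriv n e he (‖ζ - z‖ ^ 2) (by positivity)).comp_hasFDerivAt ζ h1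
  let c : EuclideanSpace ℂ (Fin n) →L[ℝ] ℂ :=
    (Complex.conjCLE : ℂ →L[ℝ] ℂ).comp ((EuclideanSpace.proj j : EuclideanSpace ℂ (Fin n) →L[ℂ] ℂ).restrictScalars ℝ)
  have h3 : HasFDerivAt (fun ζ : EuclideanSpace ℂ (Fin n) => starRingEnd ℂ (ζ j - z j)) c ζ := by
    have := c.hasFDerivAt.comp ζ ((hasFDerivAt_id ζ).sub_const z)
    simpa [c, Function.comp_def] using this
  refine ⟨_, h2.smul h3, fun v => ?_⟩
  generalize hx : ζ - z = x at *
  simp [c, hx]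

lemma dsoK_contDiff (n : ℕ) (e : ℝ) (he : 0 < e) (z : EuclideanSpace ℂ (Fin n)) (j : Fin n) :
    ContDiff ℝ 1 (dsoK n e z j) := by
  let c : EuclideanSpace ℂ (Fin n) →L[ℝ] ℂ :=
    (Complex.conjCLE : ℂ →L[ℝ] ℂ).comp ((EuclideanSpace.proj j : EuclideanSpace ℂ (Fin n) →L[ℂ] ℂ).restrictScalars ℝ)
  have h3 : ContDiff ℝ 1 (fun ζ : EuclideanSpace ℂ (Fin n) => c (ζ - z)) :=
    c.contDiff.comp (contDiff_id.sub contDiff_const)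
  have h1 : ContDiff ℝ 1 (fun ζ : EuclideanSpace ℂ (Fin n) => ((‖ζ - z‖ ^ 2 + e ^ 2) ^ n)⁻¹) := by
    refine ContDiff.inv ?_ (fun ζ => by positivity)
    exact (((contDiff_id.sub contDiff_const).norm_sq ℝ).add contDiff_const).pow n
  have := h1.smul h3
  have e : dsoK n e z j = (fun ζ : EuclideanSpace ℂ (Fin n) => ((‖ζ - z‖ ^ 2 + e ^ 2) ^ n)⁻¹) • (fun ζ => c (ζ - z)) := by
    ext ζ
    simp [dsoK, c]
  rw [e]
  exact this

lemma dsoK_div (n : ℕ) (e : ℝ) (he : 0 < e) (z : EuclideanSpace ℂ (Fin n))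
    (ζ : EuclideanSpace ℂ (Fin n)) :
    ∑ j, wirtingerDBar n (dsoK n e z j) ζ j =
      ((n * e ^ 2 / (‖ζ - z‖ ^ 2 + e ^ 2) ^ (n+1) : ℝ) : ℂ) := by
  have hD : 0 < ‖ζ - z‖ ^ 2 + e ^ 2 := by positivity
  have hj : ∀ j, wirtingerDBar n (dsoK n e z j) ζ j =
      ((((‖ζ - z‖ ^ 2 + e ^ 2) ^ n)⁻¹ - n / (‖ζ - z‖ ^ 2 + e ^ 2) ^ (n+1) * ‖(ζ - z) j‖ ^ 2 : ℝ) : ℂ) := by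
    intro j
    obtain ⟨L, hL, hv⟩ := dsoK_hasFDerivAt n e he z j ζ
    have i1 : inner ℝ (ζ - z) (EuclideanSpace.single j (1:ℂ)) = ((ζ - z) j).re := by
      simp [PiLp.inner_apply, apply_ite, Complex.inner]
    have i2 : inner ℝ (ζ - z) (EuclideanSpace.single j Complex.I) = ((ζ - z) j).im := by
      simp [PiLp.inner_apply, apply_ite, Complex.inner]
      ring
    rw [wirtingerDBar, hL.fderiv, hv, hv, i1, i2, ← Complex.normSq_eq_norm_sq]
    have hw : ζ j - z j = (ζ - z) j := rfl
    rw [hw]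
    generalize (ζ - z) j = w at *
    have hQ : (n:ℝ) / (‖ζ - z‖ ^ 2 + e ^ 2) ^ (n+1) = -(-(n:ℝ) / (‖ζ - z‖ ^ 2 + e ^ 2) ^ (n+1)) := by ring
    rw [hQ]
    generalize -(n:ℝ) / (‖ζ - z‖ ^ 2 + e ^ 2) ^ (n+1) = Q
    generalize ((‖ζ - z‖ ^ 2 + e ^ 2) ^ n)⁻¹ = P
    apply Complex.ext
    · simp [Complex.normSq_apply]; ring
    · simp; ring
  simp_rw [hj]
  rw [← Complex.ofReal_sum, Finset.sum_sub_distrib, ← Finset.mul_sum, ← EuclideanSpace.norm_sq_eq]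
  congr 1
  simp only [Finset.sum_const, Finset.card_univ, Fintype.card_fin, nsmul_eq_mul]
  field_simp
  ring

lemma dso_finrank (n : ℕ) : Module.finrank ℝ (EuclideanSpace ℂ (Fin n)) = 2 * n := by
  rw [finrank_real_of_complex]; simp

lemma dso_ibp (n : ℕ) (e : ℝ) (he : 0 < e) (z : EuclideanSpace ℂ (Fin n))
    (F : EuclideanSpace ℂ (Fin n) → ℂ) (hF : ContDiff ℝ 1 F) (hc : HasCompactSupport F) :
    ∫ ζ, ((n * e ^ 2 / (‖ζ - z‖ ^ 2 + e ^ 2) ^ (n+1) : ℝ) : ℂ) * F ζ =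
      - ∫ ζ, ∑ j, dsoK n e z j ζ * wirtingerDBar n F ζ j := by
  have hFd : ∀ v, Continuous fun ζ => fderiv ℝ F ζ v := fun v =>
    (hF.continuous_fderiv one_ne_zero).clm_apply continuous_const
  have hKd : ∀ j v, Continuous fun ζ => fderiv ℝ (dsoK n e z j) ζ v := fun j v =>
    ((dsoK_contDiff n e he z j).continuous_fderiv one_ne_zero).clm_apply continuous_const
  have hFs : ∀ v, HasCompactSupport fun ζ => fderiv ℝ F ζ v := fun v =>
    hc.fderiv_apply (𝕜 := ℝ) v
  have hK : ∀ j, Continuous (dsoK n e z j) := fun j => (dsoK_contDiff n e he z j).continuous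
  have I1 : ∀ j v, Integrable fun ζ => fderiv ℝ (dsoK n e z j) ζ v * F ζ := fun j v =>
    ((hKd j v).mul hF.continuous).integrable_of_hasCompactSupport hc.mul_left
  have I2 : ∀ j v, Integrable fun ζ => dsoK n e z j ζ * fderiv ℝ F ζ v := fun j v =>
    ((hK j).mul (hFd v)).integrable_of_hasCompactSupport (hFs v).mul_left
  have I3 : ∀ j, Integrable fun ζ => dsoK n e z j ζ * F ζ := fun j =>
    ((hK j).mul hF.continuous).integrable_of_hasCompactSupport hc.mul_left
  have P : ∀ j v, ∫ ζ, dsoK n e z j ζ * fderiv ℝ F ζ v = - ∫ ζ, fderiv ℝ (dsoK n e z j) ζ v * F ζ :=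
    fun j v => integral_mul_fderiv_eq_neg_fderiv_mul_of_integrable (I1 j v) (I2 j v) (I3 j)
      (fun x _ => ((dsoK_contDiff n e he z j).differentiable one_ne_zero) x)
      (fun x _ => (hF.differentiable one_ne_zero) x)
  have Q1 : ∀ j, Integrable fun ζ => dsoK n e z j ζ * wirtingerDBar n F ζ j := by
    intro j
    have := ((I2 j (EuclideanSpace.single j 1)).add ((I2 j (EuclideanSpace.single j Complex.I)).const_mul
      Complex.I)).const_mul (1/2)
    refine this.congr (Filter.Eventually.of_forall fun ζ => ?_)
    simp only [wirtingerDBar, Pi.add_apply]; ring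
  have Q2 : ∀ j, Integrable fun ζ => wirtingerDBar n (dsoK n e z j) ζ j * F ζ := by
    intro j
    have := ((I1 j (EuclideanSpace.single j 1)).add ((I1 j (EuclideanSpace.single j Complex.I)).const_mul
      Complex.I)).const_mul (1/2)
    refine this.congr (Filter.Eventually.of_forall fun ζ => ?_)
    simp only [wirtingerDBar, Pi.add_apply]; ring
  have Pj : ∀ j, ∫ ζ, dsoK n e z j ζ * wirtingerDBar n F ζ j =
      - ∫ ζ, wirtingerDBar n (dsoK n e z j) ζ j * F ζ := by
    intro j
    have e1 : ∫ ζ, dsoK n e z j ζ * wirtingerDBar n F ζ j = (1/2) *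
        ((∫ ζ, dsoK n e z j ζ * fderiv ℝ F ζ (EuclideanSpace.single j 1)) + Complex.I *
        ∫ ζ, dsoK n e z j ζ * fderiv ℝ F ζ (EuclideanSpace.single j Complex.I)) := by
      rw [← integral_const_mul, ← integral_add (I2 j _) ((I2 j _).const_mul _), ← integral_const_mul]
      congr 1; ext ζ; simp only [wirtingerDBar]; ring
    have e2 : ∫ ζ, wirtingerDBar n (dsoK n e z j) ζ j * F ζ = (1/2) *
        ((∫ ζ, fderiv ℝ (dsoK n e z j) ζ (EuclideanSpace.single j 1) * F ζ) + Complex.I *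
        ∫ ζ, fderiv ℝ (dsoK n e z j) ζ (EuclideanSpace.single j Complex.I) * F ζ) := by
      rw [← integral_const_mul, ← integral_add (I1 j _) ((I1 j _).const_mul _), ← integral_const_mul]
      congr 1; ext ζ; simp only [wirtingerDBar]; ring
    rw [e1, e2, P, P]; ring
  simp_rw [← dsoK_div n e he z, Finset.sum_mul]
  rw [integral_finsetSum _ fun j _ => Q1 j, integral_finsetSum _ fun j _ => Q2 j,
    ← Finset.sum_neg_distrib]
  exact Finset.sum_congr rfl fun j _ => by rw [Pj j, neg_neg]

lemma dsoK_le (n : ℕ) (e : ℝ) (he : 0 < e) (z : EuclideanSpace ℂ (Fin n)) (j : Fin n)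
    (ζ : EuclideanSpace ℂ (Fin n)) : ‖dsoK n e z j ζ‖ₑ ≤ ‖ζ - z‖ₑ ^ (-((2 * n : ℝ) - 1)) := by
  have hj : ‖ζ j - z j‖ ≤ ‖ζ - z‖ := PiLp.norm_apply_le (ζ - z) j
  rcases eq_or_ne ζ z with h | h
  · subst h
    simp [dsoK]
  have hw : 0 < ‖ζ - z‖ := norm_pos_iff.2 (sub_ne_zero.2 h)
  rw [← ofReal_norm, ← ofReal_norm, ENNReal.ofReal_rpow_of_pos hw]
  apply ENNReal.ofReal_le_ofReal
  rw [dsoK, norm_smul, Real.norm_eq_abs, abs_of_pos (by positivity), RCLike.norm_conj]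
  calc ((‖ζ - z‖ ^ 2 + e ^ 2) ^ n)⁻¹ * ‖ζ j - z j‖ ≤ ((‖ζ - z‖ ^ 2) ^ n)⁻¹ * ‖ζ - z‖ := by
        gcongr
        nlinarith
    _ = _ := by
      rw [neg_sub, sub_eq_add_neg (1:ℝ), Real.rpow_add hw, Real.rpow_one, Real.rpow_neg hw.le, mul_comm]
      congr 2
      rw [← pow_mul, ← Real.rpow_natCast]
      push_cast; rfl

lemma dso_norm_int_le (n : ℕ) (e : ℝ) (he : 0 < e) (z : EuclideanSpace ℂ (Fin n))
    (F : EuclideanSpace ℂ (Fin n) → ℂ) (hF : ContDiff ℝ 1 F) (hc : HasCompactSupport F) :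
    ‖∫ ζ, ((n * e ^ 2 / (‖ζ - z‖ ^ 2 + e ^ 2) ^ (n+1) : ℝ) : ℂ) * F ζ‖ₑ ≤
      ∫⁻ ζ, ‖ζ - z‖ₑ ^ (-((2 * n : ℝ) - 1)) * ∑ j, ‖wirtingerDBar n F ζ j‖ₑ := by
  rw [dso_ibp n e he z F hF hc, enorm_neg]
  refine (enorm_integral_le_lintegral_enorm _).trans (lintegral_mono fun ζ => ?_)
  refine (enorm_sum_le _ _).trans ?_
  rw [Finset.mul_sum]
  refine Finset.sum_le_sum fun j _ => ?_
  rw [enorm_mul]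
  gcongr
  exact dsoK_le n e he z j ζ

lemma dso_scale (n : ℕ) (e : ℝ) (he : 0 < e) (z : EuclideanSpace ℂ (Fin n))
    (F : EuclideanSpace ℂ (Fin n) → ℂ) :
    ∫ ζ, ((n * e ^ 2 / (‖ζ - z‖ ^ 2 + e ^ 2) ^ (n+1) : ℝ) : ℂ) * F ζ =
      ∫ w, ((n / (1 + ‖w‖ ^ 2) ^ (n+1) : ℝ) : ℂ) * F (z + e • w) := by
  have h1 := integral_add_left_eq_self (μ := (volume : Measure (EuclideanSpace ℂ (Fin n))))
    (fun ζ => ((n * e ^ 2 / (‖ζ - z‖ ^ 2 + e ^ 2) ^ (n+1) : ℝ) : ℂ) * F ζ) z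
  rw [← h1]
  have h2 := Measure.integral_comp_smul (volume : Measure (EuclideanSpace ℂ (Fin n)))
    (fun x => ((n * e ^ 2 / (‖z + x - z‖ ^ 2 + e ^ 2) ^ (n+1) : ℝ) : ℂ) * F (z + x)) e
  have h3 : ∫ x, ((n * e ^ 2 / (‖z + x - z‖ ^ 2 + e ^ 2) ^ (n+1) : ℝ) : ℂ) * F (z + x) =
      (e ^ (2 * n)) • ∫ x : EuclideanSpace ℂ (Fin n), ((n * e ^ 2 / (‖z + e • x - z‖ ^ 2 + e ^ 2) ^ (n+1) : ℝ) : ℂ) * F (z + e • x) := by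
    rw [h2, dso_finrank, abs_of_pos (by positivity), smul_smul, mul_inv_cancel₀ (by positivity), one_smul]
  rw [h3, ← integral_smul]
  congr 1
  ext w
  rw [Complex.real_smul, ← mul_assoc, ← Complex.ofReal_mul]
  congr 2
  rw [add_sub_cancel_left, norm_smul, Real.norm_eq_abs, abs_of_pos he]
  have : (e * ‖w‖) ^ 2 + e ^ 2 = e ^ 2 * (1 + ‖w‖ ^ 2) := by ring
  rw [this, mul_pow]
  field_simp
  ring

lemma dso_integrable (n : ℕ) :
    Integrable fun w : EuclideanSpace ℂ (Fin n) => (n / (1 + ‖w‖ ^ 2) ^ (n+1) : ℝ) := by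
  have := (integrable_rpow_neg_one_add_norm_sq (E := EuclideanSpace ℂ (Fin n)) (μ := volume)
    (r := 2 * (n + 1)) (by rw [dso_finrank]; push_cast; linarith)).const_mul (n:ℝ)
  refine this.congr (Filter.Eventually.of_forall fun w => ?_)
  have e : -(2 * ((n:ℝ) + 1)) / 2 = -((n + 1 : ℕ) : ℝ) := by push_cast; ring
  simp only [e]
  rw [Real.rpow_neg (by positivity), Real.rpow_natCast]
  rfl

lemma dso_tendsto (n : ℕ) (z : EuclideanSpace ℂ (Fin n))
    (F : EuclideanSpace ℂ (Fin n) → ℂ) (hF : Continuous F) (hc : HasCompactSupport F) :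
    Filter.Tendsto (fun e : ℝ => ∫ ζ, ((n * e ^ 2 / (‖ζ - z‖ ^ 2 + e ^ 2) ^ (n+1) : ℝ) : ℂ) * F ζ)
      (nhdsWithin 0 (Set.Ioi 0))
      (nhds (((∫ w : EuclideanSpace ℂ (Fin n), (n / (1 + ‖w‖ ^ 2) ^ (n+1) : ℝ) : ℝ) : ℂ) * F z)) := by
  obtain ⟨M, hM⟩ := hc.exists_bound_of_continuous hF
  have key : Filter.Tendsto (fun e : ℝ => ∫ w : EuclideanSpace ℂ (Fin n), ((n / (1 + ‖w‖ ^ 2) ^ (n+1) : ℝ) : ℂ) * F (z + e • w))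
      (nhdsWithin 0 (Set.Ioi 0)) (nhds (∫ w : EuclideanSpace ℂ (Fin n), ((n / (1 + ‖w‖ ^ 2) ^ (n+1) : ℝ) : ℂ) * F z)) := by
    refine tendsto_integral_filter_of_dominated_convergence
      (fun w => (n / (1 + ‖w‖ ^ 2) ^ (n+1) : ℝ) * M) ?_ ?_ ((dso_integrable n).mul_const M) ?_
    · refine Filter.Eventually.of_forall fun e => Continuous.aestronglyMeasurable ?_
      refine Continuous.mul (Complex.continuous_ofReal.comp ?_) (hF.comp (by fun_prop))
      exact continuous_const.div (by fun_prop) (fun w => by positivity)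
    · refine Filter.Eventually.of_forall fun e => Filter.Eventually.of_forall fun w => ?_
      rw [norm_mul, Complex.norm_real, Real.norm_eq_abs, abs_of_nonneg (by positivity)]
      gcongr
      exact hM _
    · refine Filter.Eventually.of_forall fun w => ?_
      refine Filter.Tendsto.const_mul _ ?_
      have : Continuous fun e : ℝ => F (z + e • w) := hF.comp (by fun_prop)
      have := (this.tendsto 0).mono_left (nhdsWithin_le_nhds (s := Set.Ioi 0))
      simpa using this
  rw [integral_mul_const, integral_complex_ofReal] at key
  refine key.congr' ?_
  filter_upwards [self_mem_nhdsWithin] with e he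
  exact (dso_scale n e he z F).symm

lemma dso_const_pos (n : ℕ) (hn : 1 ≤ n) :
    0 < ∫ w : EuclideanSpace ℂ (Fin n), (n / (1 + ‖w‖ ^ 2) ^ (n+1) : ℝ) := by
  have hn' : (0:ℝ) < n := by exact_mod_cast hn
  rw [integral_pos_iff_support_of_nonneg (fun w => by positivity) (dso_integrable n)]
  have : Function.support (fun w : EuclideanSpace ℂ (Fin n) => (n / (1 + ‖w‖ ^ 2) ^ (n+1) : ℝ)) = Set.univ := by
    ext w
    simp only [Function.mem_support, Set.mem_univ, iff_true]
    positivity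
  rw [this]
  exact isOpen_univ.measure_pos _ Set.univ_nonempty

lemma dso_repr (n : ℕ) (z : EuclideanSpace ℂ (Fin n))
    (F : EuclideanSpace ℂ (Fin n) → ℂ) (hF : ContDiff ℝ 1 F) (hc : HasCompactSupport F) :
    ENNReal.ofReal (∫ w : EuclideanSpace ℂ (Fin n), (n / (1 + ‖w‖ ^ 2) ^ (n+1) : ℝ)) * ‖F z‖ₑ ≤
      ∫⁻ ζ, ‖ζ - z‖ₑ ^ (-((2 * n : ℝ) - 1)) * ∑ j, ‖wirtingerDBar n F ζ j‖ₑ := by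
  have h := (dso_tendsto n z F hF.continuous hc).enorm
  rw [enorm_mul] at h
  have h0 : ‖((∫ w : EuclideanSpace ℂ (Fin n), (n / (1 + ‖w‖ ^ 2) ^ (n+1) : ℝ) : ℝ) : ℂ)‖ₑ =
      ENNReal.ofReal (∫ w : EuclideanSpace ℂ (Fin n), (n / (1 + ‖w‖ ^ 2) ^ (n+1) : ℝ)) := by
    rw [← ofReal_norm, Complex.norm_real, Real.norm_eq_abs, abs_of_nonneg]
    exact integral_nonneg fun w => by positivity
  rw [h0] at h
  refine le_of_tendsto h ?_
  filter_upwards [self_mem_nhdsWithin] with e he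
  exact dso_norm_int_le n e he z F hF hc

lemma dso_cutoff (n : ℕ) : ∃ L : ℝ, 0 ≤ L ∧ ∀ R a : ℝ, 0 < a → a < R →
    ∃ χ : EuclideanSpace ℂ (Fin n) → ℝ, ContDiff ℝ 1 χ ∧ (∀ ζ, ‖χ ζ‖ ≤ 1) ∧
      (∀ ζ, ‖ζ‖ ≤ a → χ ζ = 1) ∧ (∃ c < R, ∀ ζ, c ≤ ‖ζ‖ → χ ζ = 0) ∧
      (∀ ζ, ‖ζ‖ < a → fderiv ℝ χ ζ = 0) ∧
      (∀ ζ, ‖ζ‖ < R → ‖fderiv ℝ χ ζ‖ ≤ L * R / (R ^ 2 - a ^ 2)) := by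
  have hS : ContDiff ℝ 1 Real.smoothTransition := Real.smoothTransition.contDiff
  obtain ⟨M, hM⟩ := (isCompact_Icc (a := (-1:ℝ)) (b := 1)).exists_bound_of_continuousOn
    (hS.continuous_deriv le_rfl).continuousOn
  have hM0 : 0 ≤ M := (norm_nonneg _).trans (hM 0 (by norm_num))
  refine ⟨4 * M, by positivity, fun R a ha haR => ?_⟩
  have hη : 0 < (R ^ 2 - a ^ 2) / 2 := by nlinarith
  set η := (R ^ 2 - a ^ 2) / 2 with hηd
  have hR : 0 < R := ha.trans haR
  have one_of : ∀ ζ : EuclideanSpace ℂ (Fin n), ‖ζ‖ ≤ a →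
      Real.smoothTransition ((R ^ 2 - η - ‖ζ‖ ^ 2) / η) = 1 := by
    intro ζ hζ
    apply Real.smoothTransition.one_of_one_le
    rw [le_div_iff₀ hη]
    have : ‖ζ‖ ^ 2 ≤ a ^ 2 := by gcongr
    linarith
  have hsm : ContDiff ℝ 1 (fun ζ : EuclideanSpace ℂ (Fin n) =>
      Real.smoothTransition ((R ^ 2 - η - ‖ζ‖ ^ 2) / η)) :=
    hS.comp ((contDiff_const.sub (contDiff_id.norm_sq ℝ)).div_const η)
  have hz : ∀ ζ : EuclideanSpace ℂ (Fin n), ‖ζ‖ < a → fderiv ℝ (fun ζ : EuclideanSpace ℂ (Fin n) =>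
      Real.smoothTransition ((R ^ 2 - η - ‖ζ‖ ^ 2) / η)) ζ = 0 := by
    intro ζ hζ
    have : (fun ζ : EuclideanSpace ℂ (Fin n) =>
      Real.smoothTransition ((R ^ 2 - η - ‖ζ‖ ^ 2) / η)) =ᶠ[nhds ζ] fun _ => 1 := by
      filter_upwards [(isOpen_lt continuous_norm continuous_const).mem_nhds hζ] with w hw
      exact one_of w (le_of_lt hw)
    rw [this.fderiv_eq]; simp
  refine ⟨fun ζ => Real.smoothTransition ((R ^ 2 - η - ‖ζ‖ ^ 2) / η), hsm, ?_, one_of, ?_, hz, ?_⟩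
  · intro ζ
    rw [Real.norm_eq_abs, abs_of_nonneg (Real.smoothTransition.nonneg _)]
    exact Real.smoothTransition.le_one _
  · have hp : 0 ≤ R ^ 2 - η := by nlinarith
    refine ⟨Real.sqrt (R ^ 2 - η), ?_, ?_⟩
    · rw [Real.sqrt_lt' hR]; linarith
    · intro ζ hζ
      apply Real.smoothTransition.zero_of_nonpos
      rw [Real.sqrt_le_left (norm_nonneg _)] at hζ
      apply div_nonpos_of_nonpos_of_nonneg _ hη.le
      linarith
  · intro ζ hζ
    have hL0 : 0 ≤ 4 * M * R / (R ^ 2 - a ^ 2) := by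
      have : 0 < R ^ 2 - a ^ 2 := by linarith
      positivity
    by_cases h : ‖ζ‖ < a
    · rw [hz ζ h]; simpa using hL0
    push Not at h
    have h1 : HasFDerivAt (fun ζ : EuclideanSpace ℂ (Fin n) => ‖ζ‖ ^ 2) (2 • (innerSL ℝ ζ)) ζ :=
      (hasStrictFDerivAt_norm_sq ζ).hasFDerivAt
    have h2 := (h1.const_sub (R ^ 2 - η)).mul_const (η⁻¹)
    have h3 := ((hS.differentiable one_ne_zero) ((R ^ 2 - η - ‖ζ‖ ^ 2) * η⁻¹)).hasDerivAt.comp_hasFDerivAt ζ h2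
    have h4 := h3.fderiv
    have e : (fun ζ : EuclideanSpace ℂ (Fin n) => Real.smoothTransition ((R ^ 2 - η - ‖ζ‖ ^ 2) / η)) =
      Real.smoothTransition ∘ fun ζ : EuclideanSpace ℂ (Fin n) => (R ^ 2 - η - ‖ζ‖ ^ 2) * η⁻¹ := by
      ext; simp [div_eq_mul_inv]
    rw [e, h4]
    have hmem : (R ^ 2 - η - ‖ζ‖ ^ 2) * η⁻¹ ∈ Set.Icc (-1:ℝ) 1 := by
      rw [← div_eq_mul_inv]
      constructor
      · rw [le_div_iff₀ hη]
        have : ‖ζ‖ ^ 2 ≤ R ^ 2 := by gcongr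
        linarith
      · rw [div_le_iff₀ hη]
        have : a ^ 2 ≤ ‖ζ‖ ^ 2 := by gcongr
        linarith
    have hb := hM _ hmem
    calc _ ≤ M * (η⁻¹ * (2 * ‖ζ‖)) := by
          rw [norm_smul, norm_smul, norm_neg, norm_inv, Real.norm_eq_abs η, abs_of_pos hη]
          gcongr
          refine (norm_nsmul_le (n := 2)).trans ?_
          rw [innerSL_apply_norm]; simp
      _ ≤ M * (η⁻¹ * (2 * R)) := by gcongr
      _ = _ := by
        rw [show R ^ 2 - a ^ 2 = 2 * η by rw [hηd]; ring]
        field_simp; ring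

lemma dso_wirt_mul (n : ℕ) (χ : EuclideanSpace ℂ (Fin n) → ℝ) (f : EuclideanSpace ℂ (Fin n) → ℂ)
    (ζ : EuclideanSpace ℂ (Fin n)) (hχ : DifferentiableAt ℝ χ ζ) (hf : DifferentiableAt ℝ f ζ)
    (h1 : ‖χ ζ‖ ≤ 1) (j : Fin n) :
    ‖wirtingerDBar n (fun w => χ w • f w) ζ j‖ ≤
      ‖wirtingerDBar n f ζ j‖ + ‖f ζ‖ * ‖fderiv ℝ χ ζ‖ := by
  have hd : fderiv ℝ (fun w => χ w • f w) ζ = χ ζ • fderiv ℝ f ζ + (fderiv ℝ χ ζ).smulRight (f ζ) :=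
    fderiv_fun_smul hχ hf
  have e : wirtingerDBar n (fun w => χ w • f w) ζ j = (χ ζ : ℂ) * wirtingerDBar n f ζ j +
      f ζ * ((1/2) * ((fderiv ℝ χ ζ (EuclideanSpace.single j 1) : ℝ) +
        Complex.I * (fderiv ℝ χ ζ (EuclideanSpace.single j Complex.I) : ℝ))) := by
    simp only [wirtingerDBar, hd]
    simp
    ring
  have b1 : ‖((fderiv ℝ χ ζ (EuclideanSpace.single j 1) : ℝ) : ℂ)‖ ≤ ‖fderiv ℝ χ ζ‖ := by
    rw [Complex.norm_real]
    simpa using (fderiv ℝ χ ζ).le_opNorm (EuclideanSpace.single j (1:ℂ))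
  have b2 : ‖((fderiv ℝ χ ζ (EuclideanSpace.single j Complex.I) : ℝ) : ℂ)‖ ≤ ‖fderiv ℝ χ ζ‖ := by
    rw [Complex.norm_real]
    simpa using (fderiv ℝ χ ζ).le_opNorm (EuclideanSpace.single j Complex.I)
  rw [e]
  refine (norm_add_le _ _).trans (add_le_add ?_ ?_)
  · rw [norm_mul, Complex.norm_real]
    exact mul_le_of_le_one_left (norm_nonneg _) h1
  · rw [norm_mul]
    gcongr
    rw [norm_mul]
    have := norm_add_le ((fderiv ℝ χ ζ (EuclideanSpace.single j 1) : ℝ) : ℂ)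
      (Complex.I * (fderiv ℝ χ ζ (EuclideanSpace.single j Complex.I) : ℝ))
    rw [norm_mul, Complex.norm_I, one_mul] at this
    norm_num
    norm_num at b1 b2 this
    linarith

lemma dso_cut_bound (n : ℕ) (R : ℝ) : ∃ L : ℝ, 0 ≤ L ∧
    ∀ f : EuclideanSpace ℂ (Fin n) → ℂ, Continuous f → ContDiffOn ℝ 1 f (ball 0 R) →
    ∀ a : ℝ, 0 < a → a < R → ∀ z, ‖z‖ ≤ a →
    ENNReal.ofReal (∫ w : EuclideanSpace ℂ (Fin n), (n / (1 + ‖w‖ ^ 2) ^ (n+1) : ℝ)) * ‖f z‖ₑ ≤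
      (∫⁻ ζ in ball 0 R, ‖ζ - z‖ₑ ^ (-((2 * n : ℝ) - 1)) * ∑ j, ‖wirtingerDBar n f ζ j‖ₑ) +
      ENNReal.ofReal (n * (L * R / (R ^ 2 - a ^ 2))) *
       ∫⁻ ζ in ball 0 R \ ball 0 a, ‖ζ - z‖ₑ ^ (-((2 * n : ℝ) - 1)) * ‖f ζ‖ₑ := by
  obtain ⟨L, hL, H⟩ := dso_cutoff n
  refine ⟨L, hL, fun f hf hfd a ha haR z hz => ?_⟩
  obtain ⟨χ, hχ, hle, h1, ⟨c, hcR, h0⟩, hd0, hdL⟩ := H R a ha haR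
  set Λ := L * R / (R ^ 2 - a ^ 2) with hΛ
  have hΛ0 : 0 ≤ Λ := (norm_nonneg _).trans (hdL 0 (by simpa using ha.trans haR))
  have hzero : ∀ ζ, R ≤ ‖ζ‖ → (fun w => χ w • f w) =ᶠ[nhds ζ] fun _ => 0 := by
    intro ζ hζ
    filter_upwards [(isOpen_lt continuous_const continuous_norm).mem_nhds (hcR.trans_le hζ)] with w hw
    rw [h0 w (le_of_lt hw), zero_smul]
  have hfat : ∀ ζ, ‖ζ‖ < R → ContDiffAt ℝ 1 f ζ := fun ζ hζ =>
    hfd.contDiffAt (isOpen_ball.mem_nhds (by simpa using hζ))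
  have hF : ContDiff ℝ 1 (fun w => χ w • f w) := by
    rw [contDiff_iff_contDiffAt]
    intro ζ
    rcases lt_or_ge ‖ζ‖ R with h | h
    · exact hχ.contDiffAt.smul (hfat ζ h)
    · exact contDiffAt_const.congr_of_eventuallyEq (hzero ζ h)
  have hc : HasCompactSupport (fun w => χ w • f w) := by
    refine HasCompactSupport.intro (isCompact_closedBall (0 : EuclideanSpace ℂ (Fin n)) R) ?_
    intro x hx
    rw [mem_closedBall_zero_iff, not_le] at hx
    rw [h0 x (hcR.le.trans hx.le), zero_smul]
  have hrep := dso_repr n z _ hF hc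
  simp only [h1 z hz, one_smul] at hrep
  refine hrep.trans ?_
  have hpt : ∀ ζ, ‖ζ - z‖ₑ ^ (-((2 * n : ℝ) - 1)) * ∑ j, ‖wirtingerDBar n (fun w => χ w • f w) ζ j‖ₑ ≤
      (ball 0 R).indicator (fun ζ => ‖ζ - z‖ₑ ^ (-((2 * n : ℝ) - 1)) * ∑ j, ‖wirtingerDBar n f ζ j‖ₑ) ζ +
      (ball 0 R \ ball 0 a).indicator (fun ζ => ENNReal.ofReal (n * Λ) *
        (‖ζ - z‖ₑ ^ (-((2 * n : ℝ) - 1)) * ‖f ζ‖ₑ)) ζ := by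
    intro ζ
    rcases lt_or_ge ‖ζ‖ R with h | h
    · have hm : ζ ∈ ball (0 : EuclideanSpace ℂ (Fin n)) R := by simpa using h
      rw [Set.indicator_of_mem hm]
      have hb : ∀ j, ‖wirtingerDBar n (fun w => χ w • f w) ζ j‖ₑ ≤ ‖wirtingerDBar n f ζ j‖ₑ +
          ‖f ζ‖ₑ * ENNReal.ofReal ‖fderiv ℝ χ ζ‖ := by
        intro j
        have := dso_wirt_mul n χ f ζ (hχ.differentiable one_ne_zero ζ)
          ((hfat ζ h).differentiableAt one_ne_zero) (hle ζ) j
        rw [← ofReal_norm, ← ofReal_norm, ← ofReal_norm, ← ENNReal.ofReal_mul (norm_nonneg _),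
          ← ENNReal.ofReal_add (norm_nonneg _) (by positivity)]
        exact ENNReal.ofReal_le_ofReal this
      rcases lt_or_ge ‖ζ‖ a with h' | h'
      · refine le_add_right ?_
        gcongr with j
        refine (hb j).trans ?_
        rw [hd0 ζ h']; simp
      · have hm2 : ζ ∈ ball (0 : EuclideanSpace ℂ (Fin n)) R \ ball 0 a := ⟨hm, by simpa using h'⟩
        rw [Set.indicator_of_mem hm2]
        calc _ ≤ ‖ζ - z‖ₑ ^ (-((2 * n : ℝ) - 1)) * ∑ j, (‖wirtingerDBar n f ζ j‖ₑ +
              ‖f ζ‖ₑ * ENNReal.ofReal Λ) := by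
              gcongr with j
              refine (hb j).trans ?_
              gcongr
              exact hdL ζ h
          _ = _ := by
            rw [Finset.sum_add_distrib, mul_add]
            congr 1
            rw [Finset.sum_const, Finset.card_univ, Fintype.card_fin, nsmul_eq_mul,
              ENNReal.ofReal_mul (by positivity), ENNReal.ofReal_natCast]
            ring
    · have : ∀ j, wirtingerDBar n (fun w => χ w • f w) ζ j = 0 := by
        intro j
        rw [wirtingerDBar, (hzero ζ h).fderiv_eq]; simp
      simp only [this, enorm_zero, Finset.sum_const_zero, mul_zero, zero_le]
  have hmeas : Measurable fun ζ : EuclideanSpace ℂ (Fin n) =>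
      ‖ζ - z‖ₑ ^ (-((2 * n : ℝ) - 1)) * ‖f ζ‖ₑ :=
    (((measurable_id.sub_const z).enorm).pow_const _).mul hf.measurable.enorm
  calc _ ≤ _ := lintegral_mono hpt
    _ = _ := by
      rw [lintegral_add_right _ ((hmeas.const_mul _).indicator (measurableSet_ball.diff measurableSet_ball)),
        lintegral_indicator measurableSet_ball, lintegral_indicator (measurableSet_ball.diff measurableSet_ball),
        lintegral_const_mul _ hmeas]

lemma dso_bern (n : ℕ) (R a : ℝ) (ha : 0 < a) (haR : a < R) :
    1 - (a / R) ^ (2 * n) ≤ n * ((R ^ 2 - a ^ 2) / R ^ 2) := by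
  have hR : 0 < R := ha.trans haR
  have h := one_add_mul_le_pow (a := (a / R) ^ 2 - 1) (by nlinarith [sq_nonneg (a / R)]) n
  rw [add_sub_cancel, ← pow_mul] at h
  have e : (R ^ 2 - a ^ 2) / R ^ 2 = 1 - (a / R) ^ 2 := by field_simp
  rw [e]; linarith

lemma dso_pointwise (n : ℕ) (hn : 1 ≤ n) (R : ℝ) (hR : 0 < R) : ∃ C : ℝ≥0∞, C ≠ ∞ ∧
    ∀ f : EuclideanSpace ℂ (Fin n) → ℂ, Continuous f → ContDiffOn ℝ 1 f (ball 0 R) →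
    ∀ z ∈ ball (0 : EuclideanSpace ℂ (Fin n)) R,
    ‖f z‖ₑ ≤ C * ((∫⁻ ζ in ball 0 R, ‖ζ - z‖ₑ ^ (-((2 * n : ℝ) - 1)) * ∑ j, ‖wirtingerDBar n f ζ j‖ₑ) +
       ∫⁻ ζ, ‖ζ - z‖ₑ ^ (-((2 * n : ℝ) - 1)) * ‖f ζ‖ₑ ∂(dsoSigma R)) := by
  obtain ⟨L, hL, H⟩ := dso_cut_bound n R
  have hc := dso_const_pos n hn
  set c := ∫ w : EuclideanSpace ℂ (Fin n), (n / (1 + ‖w‖ ^ 2) ^ (n+1) : ℝ) with hcdef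
  set M : ℝ≥0∞ := ENNReal.ofReal (n * n * L / R) with hM
  have hc0 : ENNReal.ofReal c ≠ 0 := by simpa using hc
  refine ⟨(ENNReal.ofReal c)⁻¹ * (1 + M), ENNReal.mul_ne_top (ENNReal.inv_ne_top.2 hc0)
    (ENNReal.add_ne_top.2 ⟨ENNReal.one_ne_top, ENNReal.ofReal_ne_top⟩), fun f hf hfd z hz => ?_⟩
  have hzR : ‖z‖ < R := by simpa using hz
  set I1 := ∫⁻ ζ in ball 0 R, ‖ζ - z‖ₑ ^ (-((2 * n : ℝ) - 1)) * ∑ j, ‖wirtingerDBar n f ζ j‖ₑ with hI1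
  set I2 := ∫⁻ ζ, ‖ζ - z‖ₑ ^ (-((2 * n : ℝ) - 1)) * ‖f ζ‖ₑ ∂(dsoSigma R) with hI2
  obtain ⟨b, hzb, hbR⟩ := exists_between hzR
  have hb0 : 0 < b := (norm_nonneg z).trans_lt hzb
  have hmeas : Measurable fun ζ : EuclideanSpace ℂ (Fin n) =>
      ‖ζ - z‖ₑ ^ (-((2 * n : ℝ) - 1)) * ‖f ζ‖ₑ :=
    (((measurable_id.sub_const z).enorm).pow_const _).mul hf.measurable.enorm
  -- uniform continuity near the sphere
  have hcomp : IsCompact (closedBall (0 : EuclideanSpace ℂ (Fin n)) R \ ball 0 b) :=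
    (isCompact_closedBall _ _).diff isOpen_ball
  have hne : ∀ ζ : EuclideanSpace ℂ (Fin n), b ≤ ‖ζ‖ → 0 < ‖ζ - z‖ := by
    intro ζ hζ
    have := norm_sub_norm_le ζ z
    linarith
  have hcont : ContinuousOn (fun ζ => ‖ζ - z‖ ^ (-((2 * n : ℝ) - 1)) * ‖f ζ‖)
      (closedBall (0 : EuclideanSpace ℂ (Fin n)) R \ ball 0 b) := by
    refine ContinuousOn.mul ?_ hf.norm.continuousOn
    refine ContinuousOn.rpow_const (by fun_prop) fun ζ hζ => Or.inl ?_
    exact (hne ζ (by simpa using hζ.2)).ne'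
  have huc := hcomp.uniformContinuousOn_of_continuous hcont
  rw [Metric.uniformContinuousOn_iff] at huc
  have hofr : ∀ ζ : EuclideanSpace ℂ (Fin n), b ≤ ‖ζ‖ → ‖ζ - z‖ₑ ^ (-((2 * n : ℝ) - 1)) * ‖f ζ‖ₑ =
      ENNReal.ofReal (‖ζ - z‖ ^ (-((2 * n : ℝ) - 1)) * ‖f ζ‖) := by
    intro ζ hζ
    rw [ENNReal.ofReal_mul (by positivity), ← ENNReal.ofReal_rpow_of_pos (hne ζ hζ), ofReal_norm, ofReal_norm]
  have main : ∀ δ : ℝ, 0 < δ → ENNReal.ofReal c * ‖f z‖ₑ ≤ I1 +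
      M * (I2 + ENNReal.ofReal δ * dsoSigma R (Set.univ : Set (EuclideanSpace ℂ (Fin n)))) := by
    intro δ hδ
    obtain ⟨ε, hε, hu⟩ := huc δ hδ
    obtain ⟨a, ha1, haR⟩ := exists_between (max_lt hbR (sub_lt_self R hε))
    have hba : b < a := (le_max_left _ _).trans_lt ha1
    have hRa : R - a < ε := by linarith [(le_max_right b (R - ε)).trans_lt ha1]
    have ha0 : 0 < a := hb0.trans hba
    have h1 := H f hf hfd a ha0 haR z (hzb.trans hba).le
    refine h1.trans (add_le_add le_rfl ?_)
    have hk : Module.finrank ℝ (EuclideanSpace ℂ (Fin n)) = (2 * n - 1) + 1 := by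
      rw [dso_finrank]; omega
    have hsh := dso_shell (2 * n - 1) hk R a ha0 haR.le
      (fun ζ => ‖ζ - z‖ₑ ^ (-((2 * n : ℝ) - 1)) * ‖f ζ‖ₑ + ENNReal.ofReal δ) (hmeas.add_const _)
    have hle : ∫⁻ ζ in ball 0 R \ ball 0 a, ‖ζ - z‖ₑ ^ (-((2 * n : ℝ) - 1)) * ‖f ζ‖ₑ ≤
        ∫⁻ ζ in ball 0 R \ ball 0 a, (fun ζ => ‖ζ - z‖ₑ ^ (-((2 * n : ℝ) - 1)) * ‖f ζ‖ₑ +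
          ENNReal.ofReal δ) (dsoProj R ζ) := by
      refine setLIntegral_mono' (measurableSet_ball.diff measurableSet_ball) fun ζ hζ => ?_
      have hζR : ‖ζ‖ < R := by simpa using hζ.1
      have hζa : a ≤ ‖ζ‖ := by simpa using hζ.2
      have hζ0 : ζ ≠ 0 := norm_pos_iff.1 (ha0.trans_le hζa)
      have hpn := dso_proj_norm R hR ζ hζ0
      have hdist : dist ζ (dsoProj R ζ) < ε := by
        have e1 : ζ - dsoProj R ζ = (‖ζ‖ / R - 1) • dsoProj R ζ := by
          rw [sub_smul, one_smul, ← dso_proj_eq R hR ζ]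
        rw [dist_eq_norm, e1, norm_smul, hpn, Real.norm_eq_abs, abs_of_nonpos]
        · have : -(‖ζ‖ / R - 1) * R = R - ‖ζ‖ := by field_simp; ring
          rw [this]; linarith
        · rw [sub_nonpos, div_le_one hR]; exact hζR.le
      have := hu ζ ⟨by simpa using hζR.le, by simpa using hba.le.trans hζa⟩ (dsoProj R ζ)
        ⟨by simpa using hpn.le, by simpa [hpn] using hbR.le⟩ hdist
      rw [Real.dist_eq] at this
      have h3 := (abs_lt.1 this).2
      simp only
      rw [hofr ζ (hba.le.trans hζa), hofr (dsoProj R ζ) (by rw [hpn]; exact hbR.le),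
        ← ENNReal.ofReal_add (by positivity) hδ.le]
      apply ENNReal.ofReal_le_ofReal
      linarith
    have hpos : 0 < R ^ 2 - a ^ 2 := by nlinarith
    calc _ ≤ ENNReal.ofReal (n * (L * R / (R ^ 2 - a ^ 2))) * _ := mul_le_mul' le_rfl (hle.trans hsh.le)
      _ = ENNReal.ofReal (n * (L * R / (R ^ 2 - a ^ 2)) * (1 - (a / R) ^ (2 * n - 1 + 1))) *
          (I2 + ENNReal.ofReal δ * dsoSigma R (Set.univ : Set (EuclideanSpace ℂ (Fin n)))) := by
        rw [lintegral_add_right _ measurable_const, lintegral_const, ← mul_assoc,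
          ← ENNReal.ofReal_mul (by positivity)]
      _ ≤ _ := by
        refine mul_le_mul' (ENNReal.ofReal_le_ofReal ?_) le_rfl
        rw [show 2 * n - 1 + 1 = 2 * n by omega]
        calc _ ≤ n * (L * R / (R ^ 2 - a ^ 2)) * (n * ((R ^ 2 - a ^ 2) / R ^ 2)) := by
              gcongr; exact dso_bern n R a ha0 haR
          _ = _ := by field_simp
  have hfin : ENNReal.ofReal c * ‖f z‖ₑ ≤ I1 + M * I2 := by
    have ht : Filter.Tendsto (fun δ : ℝ => I1 +
      M * (I2 + ENNReal.ofReal δ * dsoSigma R (Set.univ : Set (EuclideanSpace ℂ (Fin n)))))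
      (nhdsWithin 0 (Set.Ioi 0)) (nhds (I1 + M * (I2 + 0))) := by
      refine Filter.Tendsto.const_add _ (ENNReal.Tendsto.const_mul (Filter.Tendsto.const_add _ ?_)
        (Or.inr ENNReal.ofReal_ne_top))
      have h1 : Filter.Tendsto (fun δ : ℝ => ENNReal.ofReal δ) (nhdsWithin 0 (Set.Ioi 0)) (nhds 0) := by
        have := (ENNReal.continuous_ofReal.tendsto 0).mono_left (nhdsWithin_le_nhds (s := Set.Ioi 0))
        simpa using this
      have := ENNReal.Tendsto.mul_const (b := dsoSigma R (Set.univ : Set (EuclideanSpace ℂ (Fin n)))) h1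
        (Or.inr (measure_ne_top _ _))
      simpa using this
    rw [add_zero] at ht
    refine ge_of_tendsto ht ?_
    filter_upwards [self_mem_nhdsWithin] with δ hδ
    exact main δ hδ
  calc ‖f z‖ₑ = (ENNReal.ofReal c)⁻¹ * (ENNReal.ofReal c * ‖f z‖ₑ) := by
        rw [← mul_assoc, ENNReal.inv_mul_cancel hc0 ENNReal.ofReal_ne_top, one_mul]
    _ ≤ (ENNReal.ofReal c)⁻¹ * ((1 + M) * (I1 + I2)) := by
        refine mul_le_mul' le_rfl (hfin.trans ?_)
        rw [add_mul, mul_add M, one_mul]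
        exact add_le_add le_self_add le_add_self
    _ = _ := by rw [mul_assoc]

lemma dso_conv {E : Type*} [NormedAddCommGroup E] [MeasurableSpace E] [BorelSpace E]
    (m : Measure E) (s K : Set E) (hK : IsCompact K) (hs : s ⊆ K) (hsm : MeasurableSet s)
    (hm : m s ≠ ∞) (h : E → ℝ) (hc : Continuous h) (h0 : ∀ z, 0 ≤ h z) (t : ℝ) (ht : 1 ≤ t) :
    ENNReal.ofReal ((∫ z in s, h z ^ t ∂m) ^ (1 / t)) =
      (∫⁻ z in s, ENNReal.ofReal (h z) ^ t ∂m) ^ (1 / t) := by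
  have ht0 : 0 < t := by linarith
  have hct : Continuous fun z => h z ^ t := hc.rpow_const fun z => Or.inr ht0.le
  obtain ⟨M, hM⟩ := hK.exists_bound_of_continuousOn hct.continuousOn
  have hInt : IntegrableOn (fun z => h z ^ t) s m := by
    refine Measure.integrableOn_of_bounded hm hct.measurable.aestronglyMeasurable (M := M) ?_
    filter_upwards [ae_restrict_mem hsm] with z hz using hM z (hs hz)
  have hnn : ∀ z, 0 ≤ h z ^ t := fun z => Real.rpow_nonneg (h0 z) _
  rw [← ENNReal.ofReal_rpow_of_nonneg (integral_nonneg hnn) (by positivity),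
    ofReal_integral_eq_lintegral_ofReal hInt (Filter.Eventually.of_forall hnn)]
  congr 1
  exact lintegral_congr fun z => (ENNReal.ofReal_rpow_of_nonneg (h0 z) ht0.le).symm

lemma dso_main_ennreal (n : ℕ) (hn : 1 ≤ n) (R : ℝ) (hR : 0 < R)
    (p q r : ℝ) (hp : 1 ≤ p) (hq : 1 ≤ q) (hr : 1 ≤ r)
    (hqp : q * (2 * n - p) < 2 * n * p) (hqr : q * (2 * n - 1) < 2 * n * r) :
    ∃ C : ℝ≥0∞, C ≠ ∞ ∧ ∀ f : EuclideanSpace ℂ (Fin n) → ℂ,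
      ∀ g : Fin n → EuclideanSpace ℂ (Fin n) → ℂ,
      Continuous f → ContDiffOn ℝ 1 f (ball 0 R) →
      (∀ j : Fin n, Continuous (g j)) →
      (∀ j : Fin n, ∀ z ∈ ball 0 R, g j z = wirtingerDBar n f z j) →
      (∫⁻ z in ball 0 R, ‖f z‖ₑ ^ q) ^ (1 / q)
        ≤ C * ((∫⁻ z in ball 0 R, ENNReal.ofReal (Real.sqrt (∑ j : Fin n, ‖g j z‖ ^ 2)) ^ p) ^ (1 / p)
          + (∫⁻ z in sphere 0 R, ‖f z‖ₑ ^ r ∂(μH[(2 * n : ℝ) - 1])) ^ (1 / r)) := by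
  have hn' : (1:ℝ) ≤ n := by exact_mod_cast hn
  have hk : Module.finrank ℝ (EuclideanSpace ℂ (Fin n)) = (2 * n - 1) + 1 := by
    rw [dso_finrank]; omega
  have hkr : ((2 * n - 1 : ℕ) : ℝ) = (2 * n : ℝ) - 1 := by
    rw [Nat.cast_sub (by omega)]; push_cast; ring
  have hp0 : 0 < p := by linarith
  have hq0 : 0 < q := by linarith
  have hr0 : 0 < r := by linarith
  obtain ⟨C0, hC0, hpt⟩ := dso_pointwise n hn R hR
  obtain ⟨Cs, hCs, -, hgrow⟩ := dso_sigma_growth (E := EuclideanSpace ℂ (Fin n)) (2 * n - 1) hk (by omega) R hR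
  obtain ⟨Ch, hCh, hhaus⟩ := dso_sigma_le_hausdorff (E := EuclideanSpace ℂ (Fin n)) (2 * n - 1) hk (by omega) R hR
  rw [hkr] at hgrow hhaus
  set μ := (volume : Measure (EuclideanSpace ℂ (Fin n))).restrict (ball 0 R) with hμ
  have : IsFiniteMeasure μ := ⟨by rw [hμ, Measure.restrict_apply_univ]; exact measure_ball_lt_top⟩
  set V := (volume : Measure (EuclideanSpace ℂ (Fin n))) (ball 0 1) with hV
  have hVt : V ≠ ∞ := measure_ball_lt_top.ne
  have hμg : ∀ z : EuclideanSpace ℂ (Fin n), ∀ ρ : ℝ, 0 < ρ →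
      μ (closedBall z ρ) ≤ V * ENNReal.ofReal ρ ^ (2 * n : ℝ) := by
    intro z ρ hρ
    refine (Measure.restrict_apply_le _ _).trans ?_
    rw [Measure.addHaar_closedBall _ _ hρ.le, dso_finrank, mul_comm, ENNReal.ofReal_pow hρ.le,
      ← ENNReal.rpow_natCast]
    push_cast; rfl
  obtain ⟨A1, hA1, k1⟩ := dso_kernel μ μ V V hVt hVt (2 * n : ℝ) (2 * n : ℝ) ((2 * n : ℝ) - 1) q p
    (by linarith) (by linarith) (by linarith) le_rfl hp hq
    (by
      have : (2 * n : ℝ) / q - ((2 * n : ℝ) - 1 - 2 * n * (1 - 1 / p)) = (2 * n * p - q * (2 * n - p)) / (q * p) := by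
        field_simp; ring
      have h2 : 0 < (2 * n * p - q * (2 * n - p)) / (q * p) := div_pos (by linarith) (by positivity)
      linarith) hμg hμg
  obtain ⟨A2, hA2, k2⟩ := dso_kernel μ (dsoSigma R) V Cs hVt hCs (2 * n : ℝ) ((2 * n : ℝ) - 1) ((2 * n : ℝ) - 1) q r
    (by linarith) (by linarith) le_rfl (by linarith) hr hq
    (by
      have : (2 * n : ℝ) / q - ((2 * n : ℝ) - 1 - (2 * n - 1) * (1 - 1 / r)) = (2 * n * r - q * (2 * n - 1)) / (q * r) := by
        field_simp; ring
      have h2 : 0 < (2 * n * r - q * (2 * n - 1)) / (q * r) := div_pos (by linarith) (by positivity)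
      linarith) hμg hgrow
  refine ⟨C0 * (A1 * n + A2 * Ch ^ (1 / r)), ?_, ?_⟩
  · refine ENNReal.mul_ne_top hC0 (ENNReal.add_ne_top.2 ⟨ENNReal.mul_ne_top hA1 (ENNReal.natCast_ne_top n),
      ENNReal.mul_ne_top hA2 (ENNReal.rpow_ne_top_of_nonneg (by positivity) hCh)⟩)
  intro f g hf hfd hg hgw
  set G : EuclideanSpace ℂ (Fin n) → ℝ≥0∞ := fun ζ => ∑ j, ‖g j ζ‖ₑ with hG
  have hGm : Measurable G := Finset.measurable_sum _ fun j _ => (hg j).measurable.enorm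
  have hfm : Measurable fun ζ => ‖f ζ‖ₑ := hf.measurable.enorm
  set P1 : EuclideanSpace ℂ (Fin n) → ℝ≥0∞ := fun z => ∫⁻ ζ, ‖ζ - z‖ₑ ^ (-((2 * n : ℝ) - 1)) * G ζ ∂μ with hP1
  set P2 : EuclideanSpace ℂ (Fin n) → ℝ≥0∞ := fun z => ∫⁻ ζ, ‖ζ - z‖ₑ ^ (-((2 * n : ℝ) - 1)) * ‖f ζ‖ₑ ∂(dsoSigma R) with hP2
  have hker : Measurable fun x : EuclideanSpace ℂ (Fin n) × EuclideanSpace ℂ (Fin n) =>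
      ‖x.2 - x.1‖ₑ ^ (-((2 * n : ℝ) - 1)) := ((measurable_snd.sub measurable_fst).enorm).pow_const _
  have hP1m : Measurable P1 := Measurable.lintegral_prod_right' (f := fun x : EuclideanSpace ℂ (Fin n) × EuclideanSpace ℂ (Fin n) =>
    ‖x.2 - x.1‖ₑ ^ (-((2 * n : ℝ) - 1)) * G x.2) (hker.mul (hGm.comp measurable_snd))
  have hP2m : Measurable P2 := Measurable.lintegral_prod_right' (f := fun x : EuclideanSpace ℂ (Fin n) × EuclideanSpace ℂ (Fin n) =>
    ‖x.2 - x.1‖ₑ ^ (-((2 * n : ℝ) - 1)) * ‖f x.2‖ₑ) (hker.mul (hfm.comp measurable_snd))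
  have hb : ∀ z ∈ ball (0 : EuclideanSpace ℂ (Fin n)) R, ‖f z‖ₑ ≤ C0 * (P1 z + P2 z) := by
    intro z hz
    refine (hpt f hf hfd z hz).trans (le_of_eq ?_)
    congr 2
    refine setLIntegral_congr_fun measurableSet_ball fun ζ hζ => ?_
    simp only [hG]
    congr 1
    exact Finset.sum_congr rfl fun j _ => by rw [hgw j ζ hζ]
  have s1 : (∫⁻ z, ‖f z‖ₑ ^ q ∂μ) ^ (1 / q) ≤ C0 * (∫⁻ z, (P1 + P2) z ^ q ∂μ) ^ (1 / q) := by
    calc (∫⁻ z, ‖f z‖ₑ ^ q ∂μ) ^ (1 / q) ≤ (∫⁻ z, C0 ^ q * (P1 + P2) z ^ q ∂μ) ^ (1 / q) := by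
          refine ENNReal.rpow_le_rpow ?_ (by positivity)
          refine setLIntegral_mono' measurableSet_ball fun z hz => ?_
          rw [← ENNReal.mul_rpow_of_nonneg _ _ hq0.le]
          exact ENNReal.rpow_le_rpow (hb z hz) hq0.le
      _ = _ := by
        rw [lintegral_const_mul _ ((hP1m.add hP2m).pow_const q), ENNReal.mul_rpow_of_nonneg _ _ (by positivity),
          ← ENNReal.rpow_mul, mul_one_div_cancel hq0.ne', ENNReal.rpow_one]
  have s2 := ENNReal.lintegral_Lp_add_le (μ := μ) hP1m.aemeasurable hP2m.aemeasurable hq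
  have s3 := k1 G hGm
  have s4 := k2 (fun ζ => ‖f ζ‖ₑ) hfm
  have s5 : (∫⁻ z, G z ^ p ∂μ) ^ (1 / p) ≤ n * (∫⁻ z, ENNReal.ofReal (Real.sqrt (∑ j : Fin n, ‖g j z‖ ^ 2)) ^ p ∂μ) ^ (1 / p) := by
    have hSm : Measurable fun z => ENNReal.ofReal (Real.sqrt (∑ j : Fin n, ‖g j z‖ ^ 2)) := by
      have : Continuous fun z => Real.sqrt (∑ j : Fin n, ‖g j z‖ ^ 2) := by fun_prop
      exact this.measurable.ennreal_ofReal
    calc _ ≤ (∫⁻ z, (n:ℝ≥0∞) ^ p * ENNReal.ofReal (Real.sqrt (∑ j : Fin n, ‖g j z‖ ^ 2)) ^ p ∂μ) ^ (1 / p) := by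
          refine ENNReal.rpow_le_rpow (lintegral_mono fun z => ?_) (by positivity)
          rw [← ENNReal.mul_rpow_of_nonneg _ _ hp0.le]
          refine ENNReal.rpow_le_rpow ?_ hp0.le
          calc G z ≤ ∑ j : Fin n, ENNReal.ofReal (Real.sqrt (∑ j : Fin n, ‖g j z‖ ^ 2)) := by
                refine Finset.sum_le_sum fun j _ => ?_
                rw [← ofReal_norm]
                refine ENNReal.ofReal_le_ofReal (Real.le_sqrt_of_sq_le ?_)
                exact Finset.single_le_sum (f := fun j => ‖g j z‖ ^ 2) (fun _ _ => by positivity) (Finset.mem_univ j)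
            _ = _ := by simp
      _ = _ := by
        rw [lintegral_const_mul _ (hSm.pow_const p), ENNReal.mul_rpow_of_nonneg _ _ (by positivity),
          ← ENNReal.rpow_mul, mul_one_div_cancel hp0.ne', ENNReal.rpow_one]
  have s6 : (∫⁻ z, ‖f z‖ₑ ^ r ∂(dsoSigma R)) ^ (1 / r) ≤ Ch ^ (1 / r) *
      (∫⁻ z in sphere 0 R, ‖f z‖ₑ ^ r ∂(μH[(2 * n : ℝ) - 1])) ^ (1 / r) := by
    rw [← ENNReal.mul_rpow_of_nonneg _ _ (by positivity)]
    refine ENNReal.rpow_le_rpow ?_ (by positivity)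
    refine (lintegral_mono' hhaus le_rfl).trans (le_of_eq ?_)
    rw [lintegral_smul_measure, smul_eq_mul]
  set X := (∫⁻ z, ENNReal.ofReal (Real.sqrt (∑ j : Fin n, ‖g j z‖ ^ 2)) ^ p ∂μ) ^ (1 / p) with hX
  set Y := (∫⁻ z in sphere 0 R, ‖f z‖ₑ ^ r ∂(μH[(2 * n : ℝ) - 1])) ^ (1 / r) with hY
  calc _ ≤ _ := s1
    _ ≤ C0 * (A1 * (n * X) + A2 * (Ch ^ (1 / r) * Y)) := by
      refine mul_le_mul' le_rfl (s2.trans (add_le_add ?_ ?_))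
      · exact s3.trans (mul_le_mul' le_rfl s5)
      · exact s4.trans (mul_le_mul' le_rfl s6)
    _ ≤ _ := by
      rw [mul_assoc]
      refine mul_le_mul' le_rfl ?_
      rw [← mul_assoc, ← mul_assoc, add_mul, mul_add, mul_add]
      exact add_le_add le_self_add le_add_self

lemma dso_main_zero (n : ℕ) (hn : 1 ≤ n) (R : ℝ) (hR : 0 < R)
    (p q r : ℝ) (hp : 1 ≤ p) (hq : 1 ≤ q) (hr : 1 ≤ r)
    (hqp : q * (2 * n - p) < 2 * n * p) (hqr : q * (2 * n - 1) < 2 * n * r) :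
    ∃ δ > (0 : ℝ), ∀ f : EuclideanSpace ℂ (Fin n) → ℂ,
      ∀ g : Fin n → EuclideanSpace ℂ (Fin n) → ℂ,
      Continuous f → ContDiffOn ℝ 1 f (ball 0 R) →
      (∀ j : Fin n, Continuous (g j)) →
      (∀ j : Fin n, ∀ z ∈ ball 0 R, g j z = wirtingerDBar n f z j) →
      δ * (∫ z in ball 0 R, ‖f z‖ ^ q) ^ (1 / q)
        ≤ (∫ z in ball 0 R, (Real.sqrt (∑ j : Fin n, ‖g j z‖ ^ 2)) ^ p) ^ (1 / p)
          + (∫ z in sphere 0 R, ‖f z‖ ^ r ∂(μH[(2 * n : ℝ) - 1])) ^ (1 / r) := by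
  obtain ⟨C, hC, H⟩ := dso_main_ennreal n hn R hR p q r hp hq hr hqp hqr
  have hk : Module.finrank ℝ (EuclideanSpace ℂ (Fin n)) = (2 * n - 1) + 1 := by
    rw [dso_finrank]; omega
  have hkr : ((2 * n - 1 : ℕ) : ℝ) = (2 * n : ℝ) - 1 := by
    rw [Nat.cast_sub (by omega)]; push_cast; ring
  have hsf := dso_sphere_finite (E := EuclideanSpace ℂ (Fin n)) (2 * n - 1) hk R hR
  rw [hkr] at hsf
  have hc0 : 0 < C.toReal + 1 := by positivity
  refine ⟨(C.toReal + 1)⁻¹, by positivity, fun f g hf hfd hg hgw => ?_⟩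
  have h := H f g hf hfd hg hgw
  simp only [← ofReal_norm] at h
  rw [← dso_conv volume (ball 0 R) (closedBall 0 R) (isCompact_closedBall _ _) ball_subset_closedBall
      measurableSet_ball measure_ball_lt_top.ne (fun z => ‖f z‖) hf.norm (fun z => norm_nonneg _) q hq,
    ← dso_conv volume (ball 0 R) (closedBall 0 R) (isCompact_closedBall _ _) ball_subset_closedBall
      measurableSet_ball measure_ball_lt_top.ne (fun z => Real.sqrt (∑ j : Fin n, ‖g j z‖ ^ 2))
      (by fun_prop) (fun z => Real.sqrt_nonneg _) p hp,
    ← dso_conv (μH[(2 * n : ℝ) - 1]) (sphere 0 R) (sphere 0 R) (isCompact_sphere _ _) subset_rfl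
      isClosed_sphere.measurableSet hsf.ne (fun z => ‖f z‖) hf.norm (fun z => norm_nonneg _) r hr,
    ← ENNReal.ofReal_add (by positivity) (by positivity), ← ENNReal.ofReal_toReal hC,
    ← ENNReal.ofReal_mul (by positivity)] at h
  have h2 := (ENNReal.ofReal_le_ofReal_iff (by positivity)).1 h
  rw [inv_mul_le_iff₀ hc0]
  refine h2.trans ?_
  gcongr
  linarith

lemma dso_tietze (n : ℕ) (R : ℝ) (φ : EuclideanSpace ℂ (Fin n) → ℂ) (h : ContinuousOn φ (closedBall 0 R)) :
    ∃ ψ : EuclideanSpace ℂ (Fin n) → ℂ, Continuous ψ ∧ ∀ z ∈ closedBall 0 R, ψ z = φ z := by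
  obtain ⟨ψ, hψ⟩ := ContinuousMap.exists_restrict_eq (isClosed_closedBall (x := (0 : EuclideanSpace ℂ (Fin n))) (ε := R))
    ⟨(closedBall 0 R).restrict φ, continuousOn_iff_continuous_restrict.1 h⟩
  refine ⟨ψ, ψ.continuous, fun z hz => ?_⟩
  exact congrArg (fun u => u ⟨z, hz⟩) hψ

lemma dso_translate (n : ℕ) (z₀ : EuclideanSpace ℂ (Fin n)) (m : Measure (EuclideanSpace ℂ (Fin n)))
    (hm : MeasurePreserving (fun w => w + z₀) m m) (s t : Set (EuclideanSpace ℂ (Fin n)))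
    (hs : MeasurableSet s) (hst : (fun w => w + z₀) ⁻¹' t = s)
    (φ ψ : EuclideanSpace ℂ (Fin n) → ℝ) (h : ∀ w ∈ s, ψ w = φ (w + z₀)) :
    ∫ z in t, φ z ∂m = ∫ w in s, ψ w ∂m := by
  rw [← hm.setIntegral_preimage_emb (Homeomorph.addRight z₀).measurableEmbedding φ t, hst]
  exact (setIntegral_congr_fun hs h).symm

theorem dbar_sobolev_inequality_ball
    (n : ℕ) (hn : 1 ≤ n) (z₀ : EuclideanSpace ℂ (Fin n)) (R : ℝ) (hR : 0 < R)
    (p q r : ℝ) (hp : 1 ≤ p) (hq : 1 ≤ q) (hr : 1 ≤ r)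
    (hqp : q * (2 * n - p) < 2 * n * p) (hqr : q * (2 * n - 1) < 2 * n * r) :
    ∃ δ > (0 : ℝ), ∀ f : EuclideanSpace ℂ (Fin n) → ℂ,
      ∀ g : Fin n → EuclideanSpace ℂ (Fin n) → ℂ,
      ContinuousOn f (closure (ball z₀ R)) →
      ContDiffOn ℝ 1 f (ball z₀ R) →
      (∀ j : Fin n, ContinuousOn (g j) (closure (ball z₀ R))) →
      (∀ j : Fin n, ∀ z ∈ ball z₀ R, g j z = wirtingerDBar n f z j) →
      δ * (∫ z in ball z₀ R, ‖f z‖ ^ q) ^ (1 / q)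
        ≤ (∫ z in ball z₀ R, (Real.sqrt (∑ j : Fin n, ‖g j z‖ ^ 2)) ^ p) ^ (1 / p)
          + (∫ z in sphere z₀ R, ‖f z‖ ^ r ∂(μH[(2 * n : ℝ) - 1])) ^ (1 / r) := by
  obtain ⟨δ, hδ, H⟩ := dso_main_zero n hn R hR p q r hp hq hr hqp hqr
  refine ⟨δ, hδ, fun f g hf hfd hg hgw => ?_⟩
  rw [closure_ball _ hR.ne'] at hf
  simp only [closure_ball _ hR.ne'] at hg
  have hmap : Set.MapsTo (fun w => w + z₀) (closedBall 0 R) (closedBall z₀ R) := by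
    intro w hw; simpa using hw
  have hmap' : Set.MapsTo (fun w => w + z₀) (ball 0 R) (ball z₀ R) := by
    intro w hw; simpa using hw
  have hadd : Continuous fun w => w + z₀ := by fun_prop
  obtain ⟨F, hFc, hF⟩ := dso_tietze n R (fun w => f (w + z₀)) (hf.comp hadd.continuousOn hmap)
  have hGex : ∀ j, ∃ ψ : EuclideanSpace ℂ (Fin n) → ℂ, Continuous ψ ∧ ∀ z ∈ closedBall 0 R, ψ z = g j (z + z₀) :=
    fun j => dso_tietze n R (fun w => g j (w + z₀)) ((hg j).comp hadd.continuousOn hmap)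
  choose G hGc hG using hGex
  have hFd : ContDiffOn ℝ 1 F (ball 0 R) := by
    have h1 : ContDiffOn ℝ 1 (fun w => f (w + z₀)) (ball 0 R) :=
      hfd.comp (contDiff_id.add contDiff_const).contDiffOn hmap'
    exact h1.congr fun w hw => hF w (ball_subset_closedBall hw)
  have hGw : ∀ j : Fin n, ∀ z ∈ ball 0 R, G j z = wirtingerDBar n F z j := by
    intro j z hz
    have he : F =ᶠ[nhds z] fun w => f (w + z₀) := by
      filter_upwards [isOpen_ball.mem_nhds hz] with w hw using hF w (ball_subset_closedBall hw)
    rw [hG j z (ball_subset_closedBall hz), hgw j _ (hmap' hz), wirtingerDBar, wirtingerDBar,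
      he.fderiv_eq, fderiv_comp_add_right]
  have h := H F G hFc hFd hGc hGw
  have mv : MeasurePreserving (fun w => w + z₀) (volume : Measure (EuclideanSpace ℂ (Fin n))) volume :=
    measurePreserving_add_right volume z₀
  have mh : MeasurePreserving (fun w => w + z₀) (μH[(2 * n : ℝ) - 1] : Measure (EuclideanSpace ℂ (Fin n)))
      (μH[(2 * n : ℝ) - 1]) :=
    (IsometryEquiv.addRight z₀).measurePreserving_hausdorffMeasure _
  have pb : (fun w => w + z₀) ⁻¹' (ball z₀ R) = ball 0 R := by ext w; simp
  have ps : (fun w => w + z₀) ⁻¹' (sphere z₀ R) = sphere 0 R := by ext w; simp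
  rw [dso_translate n z₀ volume mv (ball 0 R) (ball z₀ R) measurableSet_ball pb
      (fun z => ‖f z‖ ^ q) (fun z => ‖F z‖ ^ q)
      (fun w hw => by simp only [hF w (ball_subset_closedBall hw)]),
    dso_translate n z₀ volume mv (ball 0 R) (ball z₀ R) measurableSet_ball pb
      (fun z => (Real.sqrt (∑ j : Fin n, ‖g j z‖ ^ 2)) ^ p) (fun z => (Real.sqrt (∑ j : Fin n, ‖G j z‖ ^ 2)) ^ p)
      (fun w hw => by simp only [hG _ w (ball_subset_closedBall hw)]),
    dso_translate n z₀ (μH[(2 * n : ℝ) - 1]) mh (sphere 0 R) (sphere z₀ R) isClosed_sphere.measurableSet ps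
      (fun z => ‖f z‖ ^ r) (fun z => ‖F z‖ ^ r)
      (fun w hw => by simp only [hF w (sphere_subset_closedBall hw)])]
  exact h
end

section
/- Let n ≥ 1, let z₀ ∈ ℂⁿ, R > 0, and let B = B(z₀,R) ⊂ ℂⁿ be the open ball with boundary sphere ∂B. Let 1 ≤ p < ∞ and 1 ≤ q < ∞ satisfy q(2n−1) < 2np. Then there exists a constant δ > 0, depending only on n, p, q, R, such that for every f : ℂⁿ → ℂ that is continuous on cl(B) and holomorphic on B, one has δ·‖f‖_{L^q(B)} ≤ ‖f‖_{L^p(∂B)}. (The Euclidean-ball case of Corollary 1.11.) -/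
open Metric MeasureTheory

open Metric MeasureTheory

namespace HBI
section

theorem young_aux {a b p : ℝ} (ha : 0 ≤ a) (hb : 0 ≤ b) (hp : 1 ≤ p) :
    a * b ^ (p - 1) ≤ (1 / p) * a ^ p + (1 - 1 / p) * b ^ p := by
  have hp0 : 0 < p := by linarith
  have h1 : 1 / p ≤ 1 := by rw [div_le_one hp0]; exact hp
  have := Real.geom_mean_le_arith_mean2_weighted (w₁ := 1 / p) (w₂ := 1 - 1 / p)
    (p₁ := a ^ p) (p₂ := b ^ p) (by positivity) (by linarith) (by positivity) (by positivity)
    (by ring)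
  rw [← Real.rpow_mul ha, ← Real.rpow_mul hb] at this
  have e1 : p * (1 / p) = 1 := by field_simp
  have e2 : p * (1 - 1 / p) = p - 1 := by field_simp
  rwa [e1, e2, Real.rpow_one] at this

variable {E : Type*} [NormedAddCommGroup E] [NormedSpace ℂ E] [FiniteDimensional ℂ E]
  [MeasurableSpace E] [BorelSpace E]

/-- the holomorphic parameter integral -/
theorem diff_param (ν : Measure E) [IsFiniteMeasure ν] (d : ℝ)
    (hsupp : ∀ᵐ x ∂ν, x ∈ closedBall (0 : E) d) (f : E → ℂ) (z : E) (M : ℝ)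
    (hf : ContinuousOn f (closedBall z d)) (hf' : DifferentiableOn ℂ f (ball z d))
    (hM : ∀ x ∈ closedBall z d, ‖f x‖ ≤ M) (hd : 0 < d)
    (h : E → ℂ) (hh : AEStronglyMeasurable h ν) (K : ℝ) (hK : ∀ᵐ x ∂ν, ‖h x‖ ≤ K) :
    DiffContOnCl ℂ (fun l : ℂ => ∫ x, f (z + l • x) * h x ∂ν) (ball 0 1) := by
  have : ProperSpace E := FiniteDimensional.proper ℂ E
  have hM0 : 0 ≤ M := (norm_nonneg _).trans (hM z (by simp [hd.le]))
  have hres : ν.restrict (closedBall 0 d) = ν := Measure.restrict_eq_self_of_ae_mem hsupp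
  have hmem : ∀ l : ℂ, ‖l‖ ≤ 1 → ∀ x ∈ closedBall (0 : E) d, z + l • x ∈ closedBall z d := by
    intro l hl x hx
    simp only [mem_closedBall, dist_zero_right, dist_self_add_left, norm_smul] at hx ⊢
    nlinarith [norm_nonneg x, norm_nonneg l]
  have hmem' : ∀ l : ℂ, ‖l‖ < 1 → ∀ x ∈ closedBall (0 : E) d, z + l • x ∈ ball z d := by
    intro l hl x hx
    simp only [mem_closedBall, mem_ball, dist_zero_right, dist_self_add_left, norm_smul] at hx ⊢
    nlinarith [norm_nonneg x, norm_nonneg l]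
  have hmeas : ∀ l : ℂ, ‖l‖ ≤ 1 → AEStronglyMeasurable (fun x => f (z + l • x)) ν := by
    intro l hl
    rw [← hres]
    refine ContinuousOn.aestronglyMeasurable ?_ measurableSet_closedBall
    exact hf.comp (by fun_prop) (fun x hx => hmem l hl x hx)
  have hder : ∀ l : ℂ, ‖l‖ < 1 → ∀ x ∈ closedBall (0 : E) d,
      HasDerivAt (fun l : ℂ => f (z + l • x)) (fderiv ℂ f (z + l • x) x) l := by
    intro l hl x hx
    have h1 : HasFDerivAt f (fderiv ℂ f (z + l • x)) (z + l • x) :=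
      (hf'.differentiableAt (isOpen_ball.mem_nhds (hmem' l hl x hx))).hasFDerivAt
    have h2 : HasDerivAt (fun l : ℂ => z + l • x) x l := by
      simpa using ((hasDerivAt_id l).smul_const x).const_add z
    exact h1.comp_hasDerivAt l h2
  refine ⟨?_, ?_⟩
  · intro l₀ hl₀
    have hl₀' : ‖l₀‖ < 1 := by simpa using hl₀
    set ε := (1 - ‖l₀‖) / 3 with hε
    have hεpos : 0 < ε := by rw [hε]; linarith
    refine DifferentiableAt.differentiableWithinAt ?_
    have key := hasDerivAt_integral_of_dominated_loc_of_deriv_le (μ := ν) (𝕜 := ℂ)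
      (F := fun l x => f (z + l • x) * h x)
      (F' := fun l x => fderiv ℂ f (z + l • x) x * h x) (x₀ := l₀) (s := ball l₀ ε)
      (bound := fun _ => M / ε * K) (ball_mem_nhds _ hεpos) ?_ ?_ ?_ ?_ ?_ ?_
    · exact key.2.differentiableAt
    · filter_upwards [isOpen_ball.mem_nhds hl₀] with l hl
      exact (hmeas l (by simpa using (mem_ball_zero_iff.1 hl).le)).mul hh
    · refine Integrable.of_bound ((hmeas l₀ hl₀'.le).mul hh) (M * K) ?_
      filter_upwards [hsupp, hK] with x hx hKx
      rw [norm_mul]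
      exact mul_le_mul (hM _ (hmem _ hl₀'.le x hx)) hKx (norm_nonneg _) hM0
    · refine AEStronglyMeasurable.mul ?_ hh
      have : Measurable (fun x => fderiv ℂ f (z + l₀ • x) x) :=
        by
          have h1 : Measurable (fun x => fderiv ℂ f (z + l₀ • x)) :=
            (measurable_fderiv ℂ f).comp (by fun_prop)
          exact (isBoundedBilinearMap_apply (𝕜 := ℂ) (E := E) (F := ℂ)).continuous.measurable.comp
            (h1.prodMk measurable_id)
      exact this.aestronglyMeasurable
    · filter_upwards [hsupp, hK] with x hx hKx l hl
      rw [norm_mul]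
      refine mul_le_mul ?_ hKx (norm_nonneg _) (by positivity)
      have hsub : ∀ w ∈ closedBall l ε, ‖w‖ < 1 := by
        intro w hw
        have h1 : ‖w - l‖ ≤ ε := by simpa [dist_eq_norm] using hw
        have h2 : ‖l - l₀‖ < ε := by simpa [dist_eq_norm] using hl
        have h3 : ‖w‖ ≤ ‖w - l‖ + ‖l - l₀‖ + ‖l₀‖ := by
          calc ‖w‖ = ‖(w - l) + (l - l₀) + l₀‖ := by congr 1; ring
            _ ≤ _ := norm_add₃_le
        linarith
      rw [← (hder l (hsub l (by simp [hεpos.le])) x hx).deriv]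
      refine Complex.norm_deriv_le_of_forall_mem_sphere_norm_le hεpos ?_ ?_
      · refine DifferentiableOn.diffContOnCl ?_
        intro w hw
        rw [closure_ball _ hεpos.ne'] at hw
        exact (hder w (hsub w hw) x hx).differentiableAt.differentiableWithinAt
      · intro w hw
        exact hM _ (hmem w (hsub w (sphere_subset_closedBall hw)).le x hx)
    · exact integrable_const _
    · filter_upwards [hsupp] with x hx l hl
      have h2 : ‖l - l₀‖ < ε := by simpa [dist_eq_norm] using hl
      have h3 : ‖l‖ ≤ ‖l - l₀‖ + ‖l₀‖ := by
        calc ‖l‖ = ‖(l - l₀) + l₀‖ := by congr 1; ring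
          _ ≤ _ := norm_add_le _ _
      exact (hder l (by linarith) x hx).mul_const _
  · rw [closure_ball _ one_ne_zero]
    refine continuousOn_of_dominated (bound := fun _ => M * K) ?_ ?_ (integrable_const _) ?_
    · intro l hl
      exact (hmeas l (by simpa using hl)).mul hh
    · intro l hl
      filter_upwards [hsupp, hK] with x hx hKx
      rw [norm_mul]
      exact mul_le_mul (hM _ (hmem _ (by simpa using hl) x hx)) hKx (norm_nonneg _) hM0
    · filter_upwards [hsupp] with x hx
      refine ContinuousOn.mul ?_ continuousOn_const
      exact hf.comp (by fun_prop) (fun l hl => hmem l (by simpa using hl) x hx)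


theorem mono_mean (ν : Measure E) [IsFiniteMeasure ν]
    (hinv : ∀ c : ℂ, ‖c‖ = 1 → MeasurePreserving (fun x : E => c • x) ν ν) (d : ℝ) (hd : 0 < d)
    (hsupp : ∀ᵐ x ∂ν, x ∈ closedBall (0 : E) d) (f : E → ℂ) (z : E)
    (hf : ContinuousOn f (closedBall z d)) (hf' : DifferentiableOn ℂ f (ball z d))
    (p : ℝ) (hp : 1 ≤ p) (r : ℂ) (hr : ‖r‖ ≤ 1) :
    (∀ l : ℂ, ‖l‖ ≤ 1 → Integrable (fun x => ‖f (z + l • x)‖ ^ p) ν) ∧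
      ∫ x, ‖f (z + r • x)‖ ^ p ∂ν ≤ ∫ x, ‖f (z + x)‖ ^ p ∂ν := by
  have : ProperSpace E := FiniteDimensional.proper ℂ E
  have hp0 : 0 < p := by linarith
  obtain ⟨M, hM⟩ := (isCompact_closedBall z d).exists_bound_of_continuousOn hf
  have hM0 : 0 ≤ M := (norm_nonneg _).trans (hM z (by simp [hd.le]))
  have hres : ν.restrict (closedBall 0 d) = ν := Measure.restrict_eq_self_of_ae_mem hsupp
  have hmem : ∀ l : ℂ, ‖l‖ ≤ 1 → ∀ x ∈ closedBall (0 : E) d, z + l • x ∈ closedBall z d := by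
    intro l hl x hx
    simp only [mem_closedBall, dist_zero_right, dist_self_add_left, norm_smul] at hx ⊢
    nlinarith [norm_nonneg x, norm_nonneg l]
  have hmeas : ∀ l : ℂ, ‖l‖ ≤ 1 → AEStronglyMeasurable (fun x => f (z + l • x)) ν := by
    intro l hl
    rw [← hres]
    refine ContinuousOn.aestronglyMeasurable ?_ measurableSet_closedBall
    exact hf.comp (by fun_prop) (fun x hx => hmem l hl x hx)
  have hint : ∀ l : ℂ, ‖l‖ ≤ 1 → Integrable (fun x => ‖f (z + l • x)‖ ^ p) ν := by
    intro l hl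
    refine Integrable.of_bound (C := M ^ p) ?_ ?_
    · exact ((hmeas l hl).norm.aemeasurable.pow_const p).aestronglyMeasurable
    · filter_upwards [hsupp] with x hx
      rw [Real.norm_of_nonneg (by positivity)]
      exact Real.rpow_le_rpow (norm_nonneg _) (hM _ (hmem l hl x hx)) hp0.le
  refine ⟨hint, ?_⟩
  set h : E → ℂ := fun x => ((‖f (z + r • x)‖ ^ (p - 2) : ℝ) : ℂ) *
    (starRingEnd ℂ) (f (z + r • x)) with hh
  have hhm : AEStronglyMeasurable h ν := by
    refine AEStronglyMeasurable.mul ?_ ?_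
    · exact (Complex.measurable_ofReal.comp_aemeasurable
        ((hmeas r hr).norm.aemeasurable.pow_const _)).aestronglyMeasurable
    · exact Complex.continuous_conj.comp_aestronglyMeasurable (hmeas r hr)
  have hhn : ∀ x, ‖h x‖ ≤ ‖f (z + r • x)‖ ^ (p - 1) := by
    intro x
    simp only [hh, norm_mul, Complex.norm_real, RCLike.norm_conj]
    rw [Real.norm_of_nonneg (by positivity)]
    rcases eq_or_ne (f (z + r • x)) 0 with h0 | h0
    · rw [h0]; simp; positivity
    · have : 0 < ‖f (z + r • x)‖ := norm_pos_iff.2 h0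
      rw [← Real.rpow_add_one this.ne']
      apply le_of_eq; congr 1; ring
  have hprod : ∀ x, f (z + r • x) * h x = ((‖f (z + r • x)‖ ^ p : ℝ) : ℂ) := by
    intro x
    simp only [hh]
    rcases eq_or_ne (f (z + r • x)) 0 with h0 | h0
    · rw [h0]; simp [hp0.ne']
    · have : 0 < ‖f (z + r • x)‖ := norm_pos_iff.2 h0
      rw [mul_left_comm, Complex.mul_conj, Complex.normSq_eq_norm_sq, ← Complex.ofReal_mul,
        ← Real.rpow_natCast, ← Real.rpow_add this]
      congr 2; push_cast; ring
  have hdc := diff_param ν d hsupp f z M hf hf' hM hd h hhm (M ^ (p - 1)) (by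
    filter_upwards [hsupp] with x hx
    exact (hhn x).trans (Real.rpow_le_rpow (norm_nonneg _) (hM _ (hmem r hr x hx)) (by linarith)))
  set A := ∫ x, ‖f (z + x)‖ ^ p ∂ν
  set I := ∫ x, ‖f (z + r • x)‖ ^ p ∂ν with hI
  have hbd : ∀ l ∈ frontier (ball (0 : ℂ) 1),
      ‖∫ x, f (z + l • x) * h x ∂ν‖ ≤ (1 / p) * A + (1 - 1 / p) * I := by
    intro l hl
    rw [frontier_ball _ one_ne_zero] at hl
    have hl1 : ‖l‖ = 1 := by simpa using hl
    have hA : ∫ x, ‖f (z + l • x)‖ ^ p ∂ν = A := by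
      have hemb : MeasurableEmbedding (fun x : E => l • x) := by
        have hl0 : l ≠ 0 := by rintro rfl; simp at hl1
        exact (Homeomorph.smulOfNeZero l hl0).measurableEmbedding
      exact (hinv l hl1).integral_comp hemb (fun x => ‖f (z + x)‖ ^ p)
    rw [← hA, hI, ← integral_const_mul, ← integral_const_mul, ← integral_add
      ((hint l hl1.le).const_mul _) ((hint r hr).const_mul _)]
    refine norm_integral_le_of_norm_le
      (((hint l hl1.le).const_mul _).add ((hint r hr).const_mul _)) ?_
    refine Filter.Eventually.of_forall fun x => ?_
    rw [norm_mul]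
    exact (mul_le_mul_of_nonneg_left (hhn x) (norm_nonneg _)).trans
      (young_aux (norm_nonneg _) (norm_nonneg _) hp)
  have hfin := Complex.norm_le_of_forall_mem_frontier_norm_le isBounded_ball hdc hbd (z := r)
    (by rw [closure_ball _ one_ne_zero]; simpa using hr)
  simp only [hprod] at hfin
  rw [integral_complex_ofReal, ← hI] at hfin
  have h2 : I ≤ (1 / p) * A + (1 - 1 / p) * I := by
    refine le_trans ?_ hfin
    exact (le_abs_self I).trans (by simp)
  have h3 : 1 / p * I ≤ 1 / p * A := by linarith
  exact le_of_mul_le_mul_left h3 (by positivity)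

end

theorem polar {E : Type*} [NormedAddCommGroup E] [NormedSpace ℝ E] [FiniteDimensional ℝ E]
    [Nontrivial E] [MeasurableSpace E] [BorelSpace E] (μ : Measure E) [μ.IsAddHaarMeasure]
    (F : E → ENNReal) (hF : Measurable F) :
    ∫⁻ x, F x ∂μ = ∫⁻ r in Set.Ioi (0 : ℝ), ENNReal.ofReal (r ^ (Module.finrank ℝ E - 1)) *
      ∫⁻ x : sphere (0 : E) 1, F (r • (x : E)) ∂μ.toSphere := by
  have hm : Measurable (fun x : sphere (0 : E) 1 × Set.Ioi (0 : ℝ) => F ((x.2 : ℝ) • (x.1 : E))) :=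
    hF.comp (by fun_prop)
  calc ∫⁻ x, F x ∂μ = ∫⁻ x : ({(0 : E)}ᶜ : Set E), F x ∂(μ.comap (↑)) := by
        rw [lintegral_subtype_comap (measurableSet_singleton _).compl, restrict_compl_singleton]
    _ = ∫⁻ x, F ((x.2 : ℝ) • (x.1 : E))
          ∂μ.toSphere.prod (.volumeIoiPow (Module.finrank ℝ E - 1)) := by
        rw [← μ.measurePreserving_homeomorphUnitSphereProd.lintegral_comp hm]
        refine lintegral_congr fun x => ?_
        congr 1
        have hx : ‖(x : E)‖ ≠ 0 := norm_ne_zero_iff.2 x.2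
        simp [smul_smul, hx]
    _ = ∫⁻ r : Set.Ioi (0 : ℝ), ∫⁻ x : sphere (0 : E) 1, F ((r : ℝ) • (x : E)) ∂μ.toSphere
          ∂(.volumeIoiPow (Module.finrank ℝ E - 1)) := by
        rw [lintegral_prod_symm _ hm.aemeasurable]
    _ = _ := by
        have hG : Measurable (fun r : ℝ => ∫⁻ x : sphere (0 : E) 1, F (r • (x : E)) ∂μ.toSphere) := by
          apply Measurable.lintegral_prod_right' (f := fun y : ℝ × sphere (0 : E) 1 =>
            F (y.1 • (y.2 : E)))
          exact hF.comp (by fun_prop)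
        rw [Measure.volumeIoiPow]
        refine (lintegral_withDensity_eq_lintegral_mul _ (by fun_prop)
          (hG.comp measurable_subtype_coe)).trans ?_
        rw [← lintegral_subtype_comap measurableSet_Ioi]
        rfl

theorem map_circle {E : Type*} [NormedAddCommGroup E] [NormedSpace ℂ E] [NormedSpace ℝ E]
    [FiniteDimensional ℝ E] [MeasurableSpace E] [BorelSpace E] (μ : Measure E) [μ.IsAddHaarMeasure]
    (c : ℂ) (hc : ‖c‖ = 1) : MeasurePreserving (fun x : E => c • x) μ μ := by
  have hc0 : c ≠ 0 := by rintro rfl; simp at hc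
  have hproper : ProperSpace E := FiniteDimensional.proper ℝ E
  let e : E ≃L[ℂ] E := ContinuousLinearEquiv.smulLeft (Units.mk0 c hc0)
  have he : ∀ x, e x = c • x := fun x => rfl
  have hmap : (μ.map (fun x : E => c • x)).IsAddHaarMeasure :=
    e.toContinuousAddEquiv.isAddHaarMeasure_map μ
  refine ⟨by fun_prop, ?_⟩
  obtain ⟨k, h1⟩ : ∃ k : NNReal, μ.map (fun x : E => c • x) = k • μ :=
    ⟨_, Measure.isAddLeftInvariant_eq_smul (μ.map (fun x : E => c • x)) μ⟩
  have hball : (μ.map (fun x : E => c • x)) (ball 0 1) = μ (ball 0 1) := by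
    rw [Measure.map_apply (by fun_prop) measurableSet_ball]
    congr 1
    ext x
    simp [norm_smul, hc]
  rw [h1] at hball ⊢
  have hp : μ (ball (0 : E) 1) ≠ 0 := (measure_ball_pos μ _ one_pos).ne'
  have hf : μ (ball (0 : E) 1) ≠ ⊤ := measure_ball_lt_top.ne
  have : (k : ENNReal) = 1 := by
    have h2 : (k : ENNReal) * μ (ball (0 : E) 1) = 1 * μ (ball (0 : E) 1) := by
      rw [one_mul]; exact hball
    exact (ENNReal.mul_left_inj hp hf).1 h2
  have : k = 1 := by exact_mod_cast this
  rw [this, one_smul]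


theorem normalize_lip {E : Type*} [NormedAddCommGroup E] [NormedSpace ℝ E] {c : ℝ} (hc : 0 < c)
    {x y : E} (hx : c ≤ ‖x‖) (hy : c ≤ ‖y‖) :
    ‖‖x‖⁻¹ • x - ‖y‖⁻¹ • y‖ ≤ 2 / c * ‖x - y‖ := by
  have hx0 : 0 < ‖x‖ := by linarith
  have hy0 : 0 < ‖y‖ := by linarith
  have e : ‖x‖⁻¹ • x - ‖y‖⁻¹ • y = ‖x‖⁻¹ • ((x - y) + (‖y‖ - ‖x‖) • (‖y‖⁻¹ • y)) := by
    rw [smul_add, smul_sub, sub_smul, smul_sub, smul_smul ‖y‖, mul_inv_cancel₀ hy0.ne', one_smul,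
      smul_smul ‖x‖⁻¹ ‖x‖, inv_mul_cancel₀ hx0.ne', one_smul]
    abel
  rw [e, norm_smul]
  have h1 : ‖(x - y) + (‖y‖ - ‖x‖) • (‖y‖⁻¹ • y)‖ ≤ 2 * ‖x - y‖ := by
    refine (norm_add_le _ _).trans ?_
    have h2 : ‖(‖y‖ - ‖x‖) • (‖y‖⁻¹ • y)‖ ≤ ‖x - y‖ := by
      rw [norm_smul, norm_smul, norm_inv, norm_norm, inv_mul_cancel₀ hy0.ne', mul_one,
        norm_sub_rev x y]
      exact abs_norm_sub_norm_le y x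
    linarith
  have h3 : ‖‖x‖⁻¹‖ ≤ 1 / c := by
    rw [norm_inv, norm_norm, ← one_div]
    exact one_div_le_one_div_of_le hc hx
  calc _ ≤ (1 / c) * (2 * ‖x - y‖) := mul_le_mul h3 h1 (norm_nonneg _) (by positivity)
    _ = _ := by ring

theorem sphere_finite {E : Type*} [NormedAddCommGroup E] [NormedSpace ℝ E] [FiniteDimensional ℝ E]
    [MeasurableSpace E] [BorelSpace E] (k : ℕ) (hk : Module.finrank ℝ E = k + 1) :
    (μH[(k : ℝ)] : Measure E) (sphere (0 : E) 1) < ⊤ := by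
  have L : E ≃L[ℝ] (Fin (k + 1) → ℝ) := ContinuousLinearEquiv.ofFinrankEq (by simp [hk])
  have hnt : Nontrivial E := Module.nontrivial_of_finrank_pos (R := ℝ) (by omega)
  set N := ‖(L : E →L[ℝ] (Fin (k + 1) → ℝ))‖ + 1 with hN
  have hNpos : 0 < N := by positivity
  have hLn : ∀ v, ‖v‖ / N ≤ ‖L.symm v‖ := by
    intro v
    rw [div_le_iff₀ hNpos]
    have := (L : E →L[ℝ] (Fin (k + 1) → ℝ)).le_opNorm (L.symm v)
    simp only [ContinuousLinearEquiv.coe_coe, ContinuousLinearEquiv.apply_symm_apply] at this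
    nlinarith [norm_nonneg (L.symm v)]
  let φ : Fin (k + 1) → Bool → (Fin k → ℝ) → E := fun i b y =>
    ‖L.symm (i.insertNth (if b then 1 else -1) y)‖⁻¹ •
      L.symm (i.insertNth (α := fun _ => ℝ) (if b then 1 else -1) y)
  have hs : ∀ b : Bool, |(if b then 1 else -1 : ℝ)| = 1 := by intro b; cases b <;> simp
  have hlip : ∃ K : NNReal, ∀ i b, LipschitzWith K (φ i b) := by
    set S := ‖(L.symm : (Fin (k + 1) → ℝ) →L[ℝ] E)‖
    refine ⟨Real.toNNReal (2 / (1 / N) * S), fun i b => LipschitzWith.of_dist_le_mul fun y y' => ?_⟩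
    rw [Real.coe_toNNReal _ (by positivity), dist_eq_norm, dist_eq_norm]
    have hge : ∀ y : Fin k → ℝ, 1 / N ≤
        ‖L.symm (i.insertNth (α := fun _ => ℝ) (if b then 1 else -1) y)‖ := by
      intro y
      refine le_trans ?_ (hLn _)
      gcongr
      have := norm_le_pi_norm (i.insertNth (α := fun _ => ℝ) (if b then 1 else -1) y) i
      rw [Fin.insertNth_apply_same, Real.norm_eq_abs, hs b] at this
      exact this
    refine (normalize_lip (by positivity) (hge y) (hge y')).trans ?_
    rw [mul_assoc]
    gcongr
    rw [← map_sub]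
    refine ((L.symm : (Fin (k + 1) → ℝ) →L[ℝ] E).le_opNorm _).trans ?_
    gcongr
    rw [pi_norm_le_iff_of_nonneg (norm_nonneg _)]
    intro j
    refine Fin.succAboveCases i ?_ (fun j => ?_) j
    · simp
    · simpa using norm_le_pi_norm (y - y') j
  obtain ⟨K, hK⟩ := hlip
  have hcov : sphere (0 : E) 1 ⊆ ⋃ i, ⋃ b, φ i b '' closedBall 0 1 := by
    intro x hx
    have hx1 : ‖x‖ = 1 := by simpa using hx
    have hx0 : x ≠ 0 := by rintro rfl; simp at hx1
    have hw0 : L x ≠ 0 := by simpa using hx0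
    have hw : 0 < ‖L x‖ := norm_pos_iff.2 hw0
    obtain ⟨i, hi⟩ : ∃ i, ‖L x‖ = |L x i| := by
      obtain ⟨i, hi⟩ := Finite.exists_max (fun i => |L x i|)
      refine ⟨i, le_antisymm ?_ (norm_le_pi_norm (L x) i)⟩
      exact (pi_norm_le_iff_of_nonneg (abs_nonneg _)).2 hi
    set v := ‖L x‖⁻¹ • L x with hv
    have hvi : |v i| = 1 := by
      simp [hv, abs_mul, ← hi, hw.ne']
    have hvn : ‖v‖ = 1 := by rw [hv, norm_smul, norm_inv, norm_norm, inv_mul_cancel₀ hw.ne']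
    obtain ⟨b, hb⟩ : ∃ b : Bool, (if b then 1 else -1 : ℝ) = v i := by
      rcases (abs_eq zero_le_one).1 hvi with h | h
      · exact ⟨true, by simp [h]⟩
      · exact ⟨false, by simp [h]⟩
    simp only [Set.mem_iUnion]
    refine ⟨i, b, i.removeNth v, ?_, ?_⟩
    · rw [mem_closedBall_zero_iff, pi_norm_le_iff_of_nonneg zero_le_one]
      intro j
      exact (norm_le_pi_norm v _).trans hvn.le
    · simp only [φ]
      rw [hb, Fin.insertNth_self_removeNth, hv, map_smul, L.symm_apply_apply, norm_smul, hx1,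
        smul_smul]
      simp [hw.ne']
  refine (measure_mono hcov).trans_lt ?_
  refine (measure_iUnion_le _).trans_lt ?_
  rw [tsum_fintype]
  refine ENNReal.sum_lt_top.2 fun i _ => ?_
  refine (measure_iUnion_le _).trans_lt ?_
  rw [tsum_fintype]
  refine ENNReal.sum_lt_top.2 fun b _ => ?_
  refine ((hK i b).hausdorffMeasure_image_le (Nat.cast_nonneg k) _).trans_lt ?_
  refine ENNReal.mul_lt_top (ENNReal.rpow_lt_top_of_nonneg (by positivity) (by simp)) ?_
  have h := hausdorffMeasure_pi_real (ι := Fin k)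
  rw [Fintype.card_fin] at h
  rw [h]
  exact measure_closedBall_lt_top


open scoped Pointwise in
theorem toSphere_closedBall {E : Type*} [NormedAddCommGroup E] [NormedSpace ℝ E]
    [FiniteDimensional ℝ E]
    [MeasurableSpace E] [BorelSpace E] (μ : Measure E) [μ.IsAddHaarMeasure]
    (k : ℕ) (hk : Module.finrank ℝ E = k + 1) (x : sphere (0 : E) 1) (δ : ℝ) (hδ : 0 < δ)
    (hδ1 : δ ≤ 1) :
    μ.toSphere (closedBall x δ) ≤
      ((k + 1 : ℕ) * 2 ^ (k + 2) * μ (closedBall (0 : E) 1)) * ENNReal.ofReal (δ ^ k) := by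
  rw [μ.toSphere_apply' measurableSet_closedBall, hk]
  set K := ⌈1 / δ⌉₊ with hK
  have hx : ‖(x : E)‖ = 1 := by simp
  have hKpos : 0 < K := Nat.ceil_pos.2 (by positivity)
  have hK1 : 1 / δ ≤ K := Nat.le_ceil _
  have hK2 : (K : ℝ) ≤ 2 / δ := by
    have h1 : (K : ℝ) < 1 / δ + 1 := Nat.ceil_lt_add_one (by positivity)
    have h2 : 1 ≤ 1 / δ := by rw [le_div_iff₀ hδ]; linarith
    have h3 : 2 / δ = 1 / δ + 1 / δ := by ring
    linarith
  have hKr : (0 : ℝ) < K := by exact_mod_cast hKpos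
  have hcov : Set.Ioo (0 : ℝ) 1 • (Subtype.val '' (closedBall x δ : Set (sphere (0 : E) 1))) ⊆
      ⋃ j ∈ Finset.range K, closedBall (((j : ℝ) / K) • (x : E)) (2 * δ) := by
    rintro _ ⟨t, ht, _, ⟨y, hy, rfl⟩, rfl⟩
    have hy' : ‖(y : E) - x‖ ≤ δ := by
      rw [mem_closedBall, Subtype.dist_eq, dist_eq_norm] at hy; exact hy
    simp only [Set.mem_iUnion]
    have hj1 : (⌊t * K⌋₊ : ℝ) ≤ t * K := Nat.floor_le (mul_nonneg ht.1.le hKr.le)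
    have hj2 : t * K < ⌊t * K⌋₊ + 1 := Nat.lt_floor_add_one _
    refine ⟨⌊t * K⌋₊, ?_, ?_⟩
    · rw [Finset.mem_range]
      have : (⌊t * K⌋₊ : ℝ) < K := by nlinarith [ht.2]
      exact_mod_cast this
    · rw [mem_closedBall, dist_eq_norm]
      set j := (⌊t * K⌋₊ : ℝ)
      have e : t • (y : E) - (j / K) • (x : E) = t • ((y : E) - x) + (t - j / K) • (x : E) := by
        rw [smul_sub, sub_smul]; abel
      change ‖t • (y : E) - (j / K) • (x : E)‖ ≤ _
      rw [e]
      refine (norm_add_le _ _).trans ?_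
      rw [norm_smul, norm_smul, hx, mul_one, Real.norm_of_nonneg ht.1.le]
      have h1 : t * ‖(y : E) - x‖ ≤ δ := by nlinarith [ht.1, ht.2, norm_nonneg ((y : E) - x)]
      have h2 : ‖t - j / K‖ ≤ δ := by
        have h3 : t - j / K = (t * K - j) / K := by field_simp
        rw [h3, Real.norm_of_nonneg (div_nonneg (by linarith) hKr.le), div_le_iff₀ hKr]
        have h4 : 1 ≤ δ * K := by
          rw [div_le_iff₀ hδ] at hK1; linarith
        linarith
      linarith
  have h1 : μ (Set.Ioo (0 : ℝ) 1 • (Subtype.val '' (closedBall x δ : Set (sphere (0 : E) 1)))) ≤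
      K * (ENNReal.ofReal ((2 * δ) ^ (k + 1)) * μ (closedBall 0 1)) := by
    refine (measure_mono hcov).trans ((measure_biUnion_finset_le _ _).trans ?_)
    have : ∀ j : ℕ, μ (closedBall (((j : ℝ) / K) • (x : E)) (2 * δ)) =
        ENNReal.ofReal ((2 * δ) ^ (k + 1)) * μ (closedBall 0 1) := by
      intro j
      rw [Measure.addHaar_closedBall' _ _ (by positivity), hk]
    simp [this]
  refine (mul_le_mul_right h1 _).trans ?_
  have h2 : (K : ENNReal) * ENNReal.ofReal ((2 * δ) ^ (k + 1)) ≤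
      2 ^ (k + 2) * ENNReal.ofReal (δ ^ k) := by
    have e1 : (K : ENNReal) = ENNReal.ofReal K := by simp
    have e2 : (2 : ENNReal) ^ (k + 2) = ENNReal.ofReal (2 ^ (k + 2)) := by
      rw [ENNReal.ofReal_pow (by norm_num)]; simp
    rw [e1, e2, ← ENNReal.ofReal_mul hKr.le, ← ENNReal.ofReal_mul (by positivity)]
    apply ENNReal.ofReal_le_ofReal
    calc (K : ℝ) * (2 * δ) ^ (k + 1) ≤ 2 / δ * (2 * δ) ^ (k + 1) := by gcongr
      _ = 2 ^ (k + 2) * δ ^ k := by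
        rw [mul_pow]; field_simp; ring
  calc ((k + 1 : ℕ) : ENNReal) * (K * (ENNReal.ofReal ((2 * δ) ^ (k + 1)) * μ (closedBall 0 1)))
      = (k + 1 : ℕ) * μ (closedBall 0 1) * (K * ENNReal.ofReal ((2 * δ) ^ (k + 1))) := by ring
    _ ≤ (k + 1 : ℕ) * μ (closedBall 0 1) * (2 ^ (k + 2) * ENNReal.ofReal (δ ^ k)) := by gcongr
    _ = _ := by ring

theorem toSphere_le {E : Type*} [NormedAddCommGroup E] [NormedSpace ℝ E] [FiniteDimensional ℝ E]
    [MeasurableSpace E] [BorelSpace E] (μ : Measure E) [μ.IsAddHaarMeasure]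
    (k : ℕ) (hk : Module.finrank ℝ E = k + 1) :
    ∃ C : ENNReal, C ≠ ⊤ ∧ μ.toSphere ≤ C • (μH[(k : ℝ)] : Measure (sphere (0 : E) 1)) := by
  set C : ENNReal := (k + 1 : ℕ) * 2 ^ (k + 2) * μ (closedBall (0 : E) 1) with hC
  have hproper : ProperSpace E := FiniteDimensional.proper ℝ E
  have hCtop : C ≠ ⊤ := by
    refine ENNReal.mul_ne_top (ENNReal.mul_ne_top (by simp) (by simp)) measure_closedBall_lt_top.ne
  have hC0 : C ≠ 0 := by
    have := (measure_closedBall_pos μ (0 : E) one_pos).ne'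
    simp [hC, this]
  refine ⟨C, hCtop, ?_⟩
  have key : C⁻¹ • μ.toSphere ≤ (μH[(k : ℝ)] : Measure (sphere (0 : E) 1)) := by
    refine Measure.le_hausdorffMeasure _ _ 1 one_pos fun s hs => ?_
    rcases s.eq_empty_or_nonempty with rfl | ⟨x, hx⟩
    · simp
    rw [Measure.smul_apply, smul_eq_mul, ENNReal.inv_mul_le_iff hC0 hCtop]
    have hfin : ediam s ≠ ⊤ := ne_top_of_le_ne_top ENNReal.one_ne_top hs
    set D := (ediam s).toReal with hD
    have hDe : ediam s = ENNReal.ofReal D := (ENNReal.ofReal_toReal hfin).symm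
    have hD1 : D ≤ 1 := by
      rw [hD]; exact ENNReal.toReal_le_of_le_ofReal zero_le_one (by simpa using hs)
    have hD0 : 0 ≤ D := ENNReal.toReal_nonneg
    have hb : ∀ δ : ℝ, 0 < δ → D ≤ δ → δ ≤ 1 → μ.toSphere s ≤ C * ENNReal.ofReal (δ ^ k) := by
      intro δ h0 h1 h2
      refine (measure_mono ?_).trans (toSphere_closedBall μ k hk x δ h0 h2)
      intro y hy
      rw [mem_closedBall, ← edist_le_ofReal h0.le]
      refine (edist_le_ediam_of_mem hy hx).trans ?_
      rw [hDe]
      exact ENNReal.ofReal_le_ofReal h1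
    rw [ENNReal.rpow_natCast, hDe, ← ENNReal.ofReal_pow hD0]
    rcases hD0.lt_or_eq with h | h
    · exact hb D h le_rfl hD1
    · rw [← h]
      have ht : Filter.Tendsto (fun δ : ℝ => C * ENNReal.ofReal (δ ^ k)) (nhdsWithin 0 (Set.Ioi 0))
          (nhds (C * ENNReal.ofReal (0 ^ k))) := by
        refine ENNReal.Tendsto.const_mul ?_ (Or.inr hCtop)
        refine (ENNReal.continuous_ofReal.tendsto _).comp ?_
        exact ((continuous_pow k).tendsto 0).mono_left nhdsWithin_le_nhds
      refine ge_of_tendsto ht ?_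
      filter_upwards [Ioo_mem_nhdsGT (zero_lt_one (α := ℝ))] with δ hδ
      exact hb δ hδ.1 (by rw [← h]; exact hδ.1.le) hδ.2.le
  intro s
  have := key s
  rw [Measure.smul_apply, smul_eq_mul, ENNReal.inv_mul_le_iff hC0 hCtop] at this
  simpa using this

end HBI

open Metric MeasureTheory
namespace HBI

section

variable {E : Type*} [NormedAddCommGroup E] [NormedSpace ℂ E]
  [MeasurableSpace E] [BorelSpace E]

theorem mono_mean' [FiniteDimensional ℂ E] (ν : Measure E) [IsFiniteMeasure ν]
    (hinv : ∀ c : ℂ, ‖c‖ = 1 → MeasurePreserving (fun x : E => c • x) ν ν) (d : ℝ) (hd : 0 < d)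
    (hsupp : ∀ᵐ x ∂ν, x ∈ closedBall (0 : E) d) (f : E → ℂ) (z : E)
    (hf : ContinuousOn f (closedBall z d)) (hf' : DifferentiableOn ℂ f (ball z d))
    (p : ℝ) (hp : 1 ≤ p) (r : ℂ) (hr : ‖r‖ ≤ 1) :
    ∫⁻ x, ENNReal.ofReal (‖f (z + r • x)‖ ^ p) ∂ν ≤
      ∫⁻ x, ENNReal.ofReal (‖f (z + x)‖ ^ p) ∂ν := by
  obtain ⟨h1, h2⟩ := mono_mean ν hinv d hd hsupp f z hf hf' p hp r hr
  have h3 := h1 1 (by simp)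
  simp only [one_smul] at h3
  rw [← ofReal_integral_eq_lintegral_ofReal (h1 r hr) (.of_forall fun x => by positivity),
    ← ofReal_integral_eq_lintegral_ofReal h3 (.of_forall fun x => by positivity)]
  exact ENNReal.ofReal_le_ofReal h2

variable [NormedSpace ℝ E] [IsScalarTower ℝ ℂ E] [FiniteDimensional ℝ E]

theorem polar_ineq (μ : Measure E) [μ.IsAddHaarMeasure] (k : ℕ)
    (hk : Module.finrank ℝ E = k + 1) :
    ∃ C : ENNReal, C ≠ ⊤ ∧ ∀ F : E → ENNReal, Measurable F →
      ∫⁻ x, F x ∂μ ≤ C * ∫⁻ r in Set.Ioi (0 : ℝ), ENNReal.ofReal (r ^ k) *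
        ∫⁻ x in sphere (0 : E) 1, F (r • x) ∂(μH[(k : ℝ)]) := by
  have hnt : Nontrivial E := Module.nontrivial_of_finrank_pos (R := ℝ) (by omega)
  obtain ⟨C, hC, hle⟩ := toSphere_le μ k hk
  refine ⟨C, hC, fun F hF => ?_⟩
  rw [polar μ F hF, hk, Nat.add_sub_cancel, ← lintegral_const_mul' _ _ hC]
  refine lintegral_mono fun r => ?_
  rw [mul_left_comm]
  refine mul_le_mul_right ?_ _
  refine (lintegral_mono' hle le_rfl).trans ?_
  rw [lintegral_smul_measure, smul_eq_mul]
  refine mul_le_mul_right ?_ _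
  have h1 := (isometry_subtype_coe (s := sphere (0 : E) 1)).map_hausdorffMeasure (d := (k : ℝ))
    (Or.inl (Nat.cast_nonneg k))
  rw [Subtype.range_coe] at h1
  rw [← h1, lintegral_map (f := fun x => F (r • x)) (hF.comp (by fun_prop))
    measurable_subtype_coe]

theorem sphere_inv (d : ℝ) (c : ℂ) (hc : ‖c‖ = 1) :
    MeasurePreserving (fun x : E => c • x) ((μH[d] : Measure E).restrict (sphere 0 1))
      ((μH[d] : Measure E).restrict (sphere 0 1)) := by
  have hc0 : c ≠ 0 := by rintro rfl; simp at hc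
  let e : E ≃ᵢ E := (IsometryEquiv.mk (Homeomorph.smulOfNeZero c hc0).toEquiv
    (Isometry.of_dist_eq fun x y => by
      change dist (c • x) (c • y) = _
      rw [dist_eq_norm, ← smul_sub, norm_smul, hc, one_mul, dist_eq_norm]))
  have h := (e.measurePreserving_hausdorffMeasure d).restrict_preimage
    (isClosed_sphere.measurableSet (s := sphere (0 : E) 1))
  have h2 : e ⁻¹' (sphere 0 1) = sphere (0 : E) 1 := by
    ext x
    change c • x ∈ sphere (0 : E) 1 ↔ _
    simp [norm_smul, hc]
  rw [h2] at h
  exact h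


theorem weighted (μ : Measure E) [μ.IsAddHaarMeasure] (k : ℕ)
    (hk : Module.finrank ℝ E = k + 1) (p : ℝ) (hp : 1 ≤ p) :
    ∃ C : ENNReal, C ≠ ⊤ ∧ ∀ g : E → ℂ, ContinuousOn g (closedBall 0 1) →
      DifferentiableOn ℂ g (ball 0 1) → ∀ w : ℝ → ENNReal, Measurable w →
      ∫⁻ x in ball (0 : E) 1, w ‖x‖ * ENNReal.ofReal (‖g x‖ ^ p) ∂μ ≤
        C * (∫⁻ r in Set.Ioo (0 : ℝ) 1, w r) *
          ∫⁻ x in sphere (0 : E) 1, ENNReal.ofReal (‖g x‖ ^ p) ∂(μH[(k : ℝ)]) := by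
  obtain ⟨C, hC, hpol⟩ := polar_ineq μ k hk
  refine ⟨C, hC, fun g hg hg' w hw => ?_⟩
  have hfc : FiniteDimensional ℂ E := FiniteDimensional.right ℝ ℂ E
  set A := ∫⁻ x in sphere (0 : E) 1, ENNReal.ofReal (‖g x‖ ^ p) ∂(μH[(k : ℝ)]) with hA
  have hfin : IsFiniteMeasure ((μH[(k : ℝ)] : Measure E).restrict (sphere 0 1)) :=
    ⟨by simpa using sphere_finite k hk⟩
  have hae : ∀ᵐ x ∂((μH[(k : ℝ)] : Measure E).restrict (sphere 0 1)), x ∈ sphere (0 : E) 1 :=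
    ae_restrict_mem isClosed_sphere.measurableSet
  have hmono : ∀ r : ℝ, 0 ≤ r → r ≤ 1 →
      ∫⁻ x in sphere (0 : E) 1, ENNReal.ofReal (‖g (r • x)‖ ^ p) ∂(μH[(k : ℝ)]) ≤ A := by
    intro r hr0 hr1
    have := mono_mean' ((μH[(k : ℝ)] : Measure E).restrict (sphere 0 1))
      (fun c hc => sphere_inv k c hc) 1 one_pos
      (hae.mono fun x hx => sphere_subset_closedBall hx) g 0 hg hg' p hp (r : ℂ)
      (by simpa [abs_of_nonneg hr0] using hr1)
    simp only [zero_add] at this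
    have e : ∀ x : E, (r : ℂ) • x = r • x := fun x => algebraMap_smul ℂ r x
    simpa only [e] using this
  classical
  set g' : E → ℂ := (ball (0 : E) 1).piecewise g 0 with hg'def
  have hg'm : Measurable g' := by
    refine ContinuousOn.measurable_piecewise (hg.mono ball_subset_closedBall)
      continuousOn_const measurableSet_ball
  set F : E → ENNReal := (ball (0 : E) 1).indicator
    (fun x => w ‖x‖ * ENNReal.ofReal (‖g' x‖ ^ p)) with hF
  have hFm : Measurable F := by
    refine Measurable.indicator ?_ measurableSet_ball
    exact (hw.comp measurable_norm).mul (hg'm.norm.pow_const p).ennreal_ofReal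
  have e1 : ∫⁻ x in ball (0 : E) 1, w ‖x‖ * ENNReal.ofReal (‖g x‖ ^ p) ∂μ = ∫⁻ x, F x ∂μ := by
    rw [hF, lintegral_indicator measurableSet_ball]
    refine setLIntegral_congr_fun measurableSet_ball fun x hx => ?_
    simp only [hg'def, Set.piecewise_eq_of_mem _ _ _ hx]
  rw [e1, mul_assoc]
  refine (hpol F hFm).trans (mul_le_mul_right ?_ _)
  rw [← lintegral_mul_const _ hw, ← lintegral_indicator measurableSet_Ioo,
    ← lintegral_indicator measurableSet_Ioi]
  refine lintegral_mono fun r => ?_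
  by_cases hr0 : 0 < r
  swap
  · simp [hr0]
  rw [Set.indicator_of_mem (Set.mem_Ioi.2 hr0)]
  by_cases hr1 : r < 1
  · rw [Set.indicator_of_mem (Set.mem_Ioo.2 ⟨hr0, hr1⟩)]
    have e2 : ∫⁻ x in sphere (0 : E) 1, F (r • x) ∂(μH[(k : ℝ)]) ≤ w r * A := by
      calc ∫⁻ x in sphere (0 : E) 1, F (r • x) ∂(μH[(k : ℝ)])
          ≤ ∫⁻ x in sphere (0 : E) 1, w r * ENNReal.ofReal (‖g' (r • x)‖ ^ p) ∂(μH[(k : ℝ)]) := by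
            refine lintegral_mono_ae (hae.mono fun x hx => ?_)
            have hx1 : ‖x‖ = 1 := by simpa using hx
            have : ‖r • x‖ = r := by rw [norm_smul, hx1, Real.norm_of_nonneg hr0.le, mul_one]
            rw [hF]
            refine (Set.indicator_le_self' (fun _ _ => zero_le) _).trans ?_
            rw [this]
        _ = w r * ∫⁻ x in sphere (0 : E) 1, ENNReal.ofReal (‖g' (r • x)‖ ^ p) ∂(μH[(k : ℝ)]) := by
            rw [lintegral_const_mul]
            exact ((hg'm.comp (measurable_const_smul r)).norm.pow_const p).ennreal_ofReal
        _ ≤ w r * A := by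
            refine mul_le_mul_right (le_trans (lintegral_mono_ae (hae.mono fun x hx => ?_))
              (hmono r hr0.le hr1.le)) _
            have hx1 : ‖x‖ = 1 := by simpa using hx
            have : r • x ∈ ball (0 : E) 1 := by
              rw [mem_ball_zero_iff, norm_smul, hx1, Real.norm_of_nonneg hr0.le, mul_one]
              exact hr1
            simp only [hg'def, Set.piecewise_eq_of_mem _ _ _ this, le_refl]
    refine (mul_le_mul' (ENNReal.ofReal_le_one.2 (pow_le_one₀ hr0.le hr1.le)) e2).trans ?_
    rw [one_mul]
  · have e2 : ∫⁻ x in sphere (0 : E) 1, F (r • x) ∂(μH[(k : ℝ)]) = 0 := by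
      rw [← lintegral_zero (μ := (μH[(k : ℝ)] : Measure E).restrict (sphere 0 1))]
      refine lintegral_congr_ae (hae.mono fun x hx => ?_)
      have hx1 : ‖x‖ = 1 := by simpa using hx
      have : r • x ∉ ball (0 : E) 1 := by
        rw [mem_ball_zero_iff, norm_smul, hx1, Real.norm_of_nonneg hr0.le, mul_one]
        exact hr1
      simp only [hF, Set.indicator_of_notMem this]
    rw [e2, mul_zero]
    exact zero_le

end
end HBI

open Metric MeasureTheory
namespace HBI

section

variable {E : Type*} [NormedAddCommGroup E] [NormedSpace ℂ E]
  [MeasurableSpace E] [BorelSpace E]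
  [NormedSpace ℝ E] [IsScalarTower ℝ ℂ E] [FiniteDimensional ℝ E]

theorem sphere_lint (k : ℕ) (hk : Module.finrank ℝ E = k + 1) (p : ℝ) (hp : 1 ≤ p)
    (g : E → ℂ) (hg : ContinuousOn g (closedBall 0 1)) :
    ∫⁻ x in sphere (0 : E) 1, ENNReal.ofReal (‖g x‖ ^ p) ∂(μH[(k : ℝ)]) =
      ENNReal.ofReal (∫ x in sphere (0 : E) 1, ‖g x‖ ^ p ∂(μH[(k : ℝ)])) := by
  have hproper : ProperSpace E := FiniteDimensional.proper ℝ E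
  rw [ofReal_integral_eq_lintegral_ofReal ?_ (.of_forall fun x => by positivity)]
  have h1 : ContinuousOn (fun x => ‖g x‖ ^ p) (sphere (0 : E) 1) :=
    ((hg.mono sphere_subset_closedBall).norm).rpow_const (fun x _ => Or.inr (by linarith))
  exact h1.integrableOn_of_subset_isCompact (isCompact_sphere _ _) isClosed_sphere.measurableSet
    subset_rfl (sphere_finite k hk).ne

theorem pointwise (μ : Measure E) [μ.IsAddHaarMeasure] (k : ℕ)
    (hk : Module.finrank ℝ E = k + 1) (p : ℝ) (hp : 1 ≤ p) :
    ∃ C : ℝ, 0 ≤ C ∧ ∀ g : E → ℂ, ContinuousOn g (closedBall 0 1) →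
      DifferentiableOn ℂ g (ball 0 1) → ∀ z ∈ ball (0 : E) 1,
      ‖g z‖ ^ p ≤ C * (∫ x in sphere (0 : E) 1, ‖g x‖ ^ p ∂(μH[(k : ℝ)])) *
        (1 - ‖z‖) ^ (-(k : ℝ)) := by
  obtain ⟨C, hC, hw⟩ := weighted μ k hk p hp
  have hproper : ProperSpace E := FiniteDimensional.proper ℝ E
  have hfc : FiniteDimensional ℂ E := FiniteDimensional.right ℝ ℂ E
  have hnt : Nontrivial E := Module.nontrivial_of_finrank_pos (R := ℝ) (by omega)
  set b := μ.real (ball (0 : E) 1) with hb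
  have hbpos : 0 < b :=
    ENNReal.toReal_pos (measure_ball_pos μ _ one_pos).ne' measure_ball_lt_top.ne
  refine ⟨C.toReal * 2 / b, by positivity, fun g hg hg' z hz => ?_⟩
  set A := ∫ x in sphere (0 : E) 1, ‖g x‖ ^ p ∂(μH[(k : ℝ)]) with hA
  have hA0 : 0 ≤ A := integral_nonneg fun x => by positivity
  have hz1 : ‖z‖ < 1 := by simpa using hz
  set d := 1 - ‖z‖ with hd
  have hd0 : 0 < d := by linarith
  have hsub : ball z d ⊆ ball (0 : E) 1 := by
    intro x hx
    rw [mem_ball, dist_eq_norm] at hx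
    rw [mem_ball_zero_iff]
    have := norm_add_le (x - z) z
    rw [sub_add_cancel] at this
    linarith
  have hsubc : closedBall z d ⊆ closedBall (0 : E) 1 := by
    intro x hx
    rw [mem_closedBall, dist_eq_norm] at hx
    rw [mem_closedBall_zero_iff]
    have := norm_add_le (x - z) z
    rw [sub_add_cancel] at this
    linarith
  haveI : IsFiniteMeasure (μ.restrict (ball (0:E) d)) := ⟨by simpa using measure_ball_lt_top⟩
  have h1 := mono_mean' (μ.restrict (ball 0 d)) (fun c hc => by
      have h := (map_circle μ c hc).restrict_preimage (measurableSet_ball (x := (0 : E)) (ε := d))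
      have h2 : (fun x : E => c • x) ⁻¹' (ball 0 d) = ball (0 : E) d := by
        ext x; simp [norm_smul, hc]
      rwa [h2] at h) d hd0
    ((ae_restrict_mem measurableSet_ball).mono fun x hx => ball_subset_closedBall hx) g z
    (hg.mono hsubc) (hg'.mono hsub) p hp 0 (by simp)
  simp only [zero_smul, add_zero, lintegral_const, Measure.restrict_apply MeasurableSet.univ,
    Set.univ_inter] at h1
  have h2 : ∫⁻ x in ball (0 : E) d, ENNReal.ofReal (‖g (z + x)‖ ^ p) ∂μ =
      ∫⁻ x in ball z d, ENNReal.ofReal (‖g x‖ ^ p) ∂μ := by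
    have h := (measurePreserving_add_left μ z).setLIntegral_comp_preimage_emb
      (measurableEmbedding_addLeft z) (fun x => ENNReal.ofReal (‖g x‖ ^ p)) (ball z d)
    rw [← h]
    congr 2
    ext x; simp
  rw [h2] at h1
  set w : ℝ → ENNReal := (Set.Ioi (1 - 2 * d)).indicator 1 with hwdef
  have h3 : ∫⁻ x in ball z d, ENNReal.ofReal (‖g x‖ ^ p) ∂μ ≤
      ∫⁻ x in ball (0 : E) 1, w ‖x‖ * ENNReal.ofReal (‖g x‖ ^ p) ∂μ := by
    refine le_trans ?_ (lintegral_mono_set hsub)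
    refine setLIntegral_mono_ae' measurableSet_ball (.of_forall fun x hx => ?_)
    have : 1 - 2 * d < ‖x‖ := by
      rw [mem_ball, dist_eq_norm] at hx
      have h := norm_sub_norm_le z x
      rw [norm_sub_rev] at h
      linarith
    rw [hwdef, Set.indicator_of_mem (Set.mem_Ioi.2 this)]
    simp
  have h4 : ∫⁻ r in Set.Ioo (0 : ℝ) 1, w r ≤ ENNReal.ofReal (2 * d) := by
    rw [hwdef, lintegral_indicator_one measurableSet_Ioi,
      Measure.restrict_apply measurableSet_Ioi]
    refine (measure_mono (t := Set.Ioo (1 - 2 * d) 1) fun x hx => ⟨hx.1, hx.2.2⟩).trans ?_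
    rw [Real.volume_Ioo]
    exact ENNReal.ofReal_le_ofReal (by linarith)
  have h5 := hw g hg hg' w (measurable_one.indicator measurableSet_Ioi)
  rw [sphere_lint k hk p hp g hg, ← hA] at h5
  have h6 : ENNReal.ofReal (‖g z‖ ^ p) * μ (ball 0 d) ≤
      C * ENNReal.ofReal (2 * d) * ENNReal.ofReal A :=
    h1.trans (h3.trans (h5.trans (by gcongr)))
  have h7 := ENNReal.toReal_mono (by finiteness) h6
  simp only [ENNReal.toReal_mul] at h7
  rw [ENNReal.toReal_ofReal (by positivity), ENNReal.toReal_ofReal (by positivity),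
    ENNReal.toReal_ofReal hA0, μ.addHaar_ball _ hd0.le, hk, ENNReal.toReal_mul,
    ENNReal.toReal_ofReal (by positivity)] at h7
  change _ * (d ^ (k + 1) * b) ≤ _ at h7
  rw [Real.rpow_neg hd0.le, Real.rpow_natCast]
  have h8 : C.toReal * 2 / b * A * (d ^ k)⁻¹ = (C.toReal * (2 * d) * A) / (d ^ (k + 1) * b) := by
    field_simp
    ring
  rw [h8, le_div_iff₀ (by positivity)]
  exact h7

theorem core_ge (μ : Measure E) [μ.IsAddHaarMeasure] (k : ℕ)
    (hk : Module.finrank ℝ E = k + 1) (p q : ℝ) (hp : 1 ≤ p) (hq : p ≤ q)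
    (hqp : q * k < (k + 1) * p) :
    ∃ C : ℝ, 0 ≤ C ∧ ∀ g : E → ℂ, ContinuousOn g (closedBall 0 1) →
      DifferentiableOn ℂ g (ball 0 1) →
      ∫ x in ball (0 : E) 1, ‖g x‖ ^ q ∂μ ≤
        C * (∫ x in sphere (0 : E) 1, ‖g x‖ ^ p ∂(μH[(k : ℝ)])) ^ (q / p) := by
  obtain ⟨C, hC, hw⟩ := weighted μ k hk p hp
  obtain ⟨C2, hC2, hpt⟩ := pointwise μ k hk p hp
  have hp0 : 0 < p := by linarith
  set t := (q - p) / p with ht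
  have ht0 : 0 ≤ t := div_nonneg (by linarith) hp0.le
  have hkt : k * t < 1 := by
    rw [ht, mul_div_assoc', div_lt_one hp0]; linarith
  set w : ℝ → ENNReal := fun r => ENNReal.ofReal ((1 - r) ^ (-(k * t))) with hwdef
  have hwm : Measurable w := by
    refine Measurable.ennreal_ofReal ?_
    exact (measurable_const.sub measurable_id).pow_const _
  have hW : ∫⁻ r in Set.Ioo (0 : ℝ) 1, w r ≠ ⊤ := by
    have h1 : IntegrableOn (fun r : ℝ => (1 - r) ^ (-(k * t))) (Set.Ioo 0 1) := by
      have h2 : IntervalIntegrable (fun r : ℝ => r ^ (-(k * t))) volume 0 1 :=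
        intervalIntegral.intervalIntegrable_rpow' (by linarith)
      have h3 := (h2.comp_sub_left 1).symm
      simp only [sub_zero, sub_self] at h3
      exact (intervalIntegrable_iff_integrableOn_Ioo_of_le zero_le_one).1 h3
    rw [hwdef, ← ofReal_integral_eq_lintegral_ofReal h1]
    · simp
    · refine (ae_restrict_mem measurableSet_Ioo).mono fun r hr => ?_
      exact Real.rpow_nonneg (by linarith [hr.2]) _
  set W := ∫⁻ r in Set.Ioo (0 : ℝ) 1, w r with hWdef
  refine ⟨C2 ^ t * (C.toReal * W.toReal), by positivity, fun g hg hg' => ?_⟩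
  set A := ∫ x in sphere (0 : E) 1, ‖g x‖ ^ p ∂(μH[(k : ℝ)]) with hA
  have hA0 : 0 ≤ A := integral_nonneg fun x => by positivity
  have h5 := hw g hg hg' w hwm
  rw [sphere_lint k hk p hp g hg, ← hA, ← hWdef] at h5
  have h6 : ∫⁻ x in ball (0 : E) 1, ENNReal.ofReal (‖g x‖ ^ q) ∂μ ≤
      ENNReal.ofReal ((C2 * A) ^ t) * (C * W * ENNReal.ofReal A) := by
    refine le_trans ?_ (mul_le_mul_right h5 _)
    rw [← lintegral_const_mul' _ _ ENNReal.ofReal_ne_top]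
    refine setLIntegral_mono_ae' measurableSet_ball (.of_forall fun x hx => ?_)
    have hx1 : 0 < 1 - ‖x‖ := by
      have : ‖x‖ < 1 := by simpa using hx
      linarith
    rw [hwdef, ← ENNReal.ofReal_mul (by positivity), ← ENNReal.ofReal_mul (by positivity)]
    apply ENNReal.ofReal_le_ofReal
    have e1 : ‖g x‖ ^ q = (‖g x‖ ^ p) ^ t * ‖g x‖ ^ p := by
      rw [← Real.rpow_mul (norm_nonneg _), ← Real.rpow_add_of_nonneg (norm_nonneg _)
        (by positivity) hp0.le]
      congr 1
      rw [ht]; field_simp; ring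
    rw [e1, ← mul_assoc]
    refine mul_le_mul_of_nonneg_right ?_ (by positivity)
    have e2 : (1 - ‖x‖) ^ (-(k * t)) = ((1 - ‖x‖) ^ (-(k : ℝ))) ^ t := by
      rw [← Real.rpow_mul hx1.le]; congr 1; ring
    rw [e2, ← Real.mul_rpow (by positivity) (by positivity)]
    exact Real.rpow_le_rpow (by positivity) (hpt g hg hg' x hx) ht0
  have h7 : ∫ x in ball (0 : E) 1, ‖g x‖ ^ q ∂μ ≤ (C2 * A) ^ t * (C.toReal * W.toReal * A) := by
    rw [integral_eq_lintegral_of_nonneg_ae (.of_forall fun x => by positivity) ?_]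
    · have := ENNReal.toReal_mono (by finiteness) h6
      simpa only [ENNReal.toReal_mul, ENNReal.toReal_ofReal hA0,
        ENNReal.toReal_ofReal (Real.rpow_nonneg (mul_nonneg hC2 hA0) t)] using this
    · refine ContinuousOn.aestronglyMeasurable ?_ measurableSet_ball
      exact ((hg.mono ball_subset_closedBall).norm).rpow_const
        (fun x _ => Or.inr (by linarith))
  refine h7.trans (le_of_eq ?_)
  have e3 : A ^ (q / p) = A ^ t * A := by
    have : q / p = t + 1 := by rw [ht]; field_simp; ring
    rw [this, Real.rpow_add_one' hA0 (by linarith)]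
  rw [e3, Real.mul_rpow hC2 hA0]
  ring

theorem core_lt (μ : Measure E) [μ.IsAddHaarMeasure] (k : ℕ)
    (hk : Module.finrank ℝ E = k + 1) (p q : ℝ) (hq : 1 ≤ q) (hqp : q < p) :
    ∃ C : ℝ, 0 ≤ C ∧ ∀ g : E → ℂ, ContinuousOn g (closedBall 0 1) →
      DifferentiableOn ℂ g (ball 0 1) →
      ∫ x in ball (0 : E) 1, ‖g x‖ ^ q ∂μ ≤
        C * (∫ x in sphere (0 : E) 1, ‖g x‖ ^ p ∂(μH[(k : ℝ)])) ^ (q / p) := by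
  have hp : 1 ≤ p := by linarith
  have hp0 : 0 < p := by linarith
  have hproper : ProperSpace E := FiniteDimensional.proper ℝ E
  obtain ⟨C, hC, hw⟩ := core_ge μ k hk p p hp le_rfl (by nlinarith)
  obtain ⟨C2, hC2, hpt⟩ := pointwise μ k hk p hp
  refine ⟨μ.real (ball (0 : E) 1) + C, by positivity, fun g hg hg' => ?_⟩
  have h5 := hw g hg hg'
  have h6 := hpt g hg hg'
  set A := ∫ x in sphere (0 : E) 1, ‖g x‖ ^ p ∂(μH[(k : ℝ)]) with hA
  have hA0 : 0 ≤ A := integral_nonneg fun x => by positivity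
  have hint : ∀ s : ℝ, 0 ≤ s → IntegrableOn (fun x => ‖g x‖ ^ s) (ball (0 : E) 1) μ := by
    intro s hs
    have h1 : ContinuousOn (fun x => ‖g x‖ ^ s) (closedBall (0 : E) 1) :=
      hg.norm.rpow_const (fun x _ => Or.inr hs)
    exact (h1.integrableOn_compact (isCompact_closedBall _ _)).mono_set ball_subset_closedBall
  rcases hA0.eq_or_lt with hA0 | hA0
  · have h7 : ∫ x in ball (0 : E) 1, ‖g x‖ ^ q ∂μ = 0 := by
      refine setIntegral_eq_zero_of_forall_eq_zero fun x hx => ?_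
      have := h6 x hx
      rw [← hA0] at this
      simp only [mul_zero, zero_mul] at this
      have h8 : ‖g x‖ ^ p = 0 := le_antisymm this (by positivity)
      rw [Real.rpow_eq_zero (norm_nonneg _) hp0.ne'] at h8
      rw [h8, Real.zero_rpow (by linarith)]
    rw [h7]; positivity
  · rw [div_self hp0.ne', Real.rpow_one] at h5
    set a := A ^ (1 / p) with ha
    have ha0 : 0 < a := by positivity
    have hap : a ^ p = A := by rw [ha, ← Real.rpow_mul hA0.le]; simp [hp0.ne']
    have haq : A ^ (q / p) = a ^ q := by
      rw [ha, ← Real.rpow_mul hA0.le]; congr 1; ring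
    have hpt : ∀ x, ‖g x‖ ^ q ≤ a ^ q + a ^ (q - p) * ‖g x‖ ^ p := by
      intro x
      rcases le_total ‖g x‖ a with h | h
      · have h1 := Real.rpow_le_rpow (norm_nonneg _) h (by linarith : 0 ≤ q)
        have h2 : 0 ≤ a ^ (q - p) * ‖g x‖ ^ p := by positivity
        linarith
      · have hg0 : 0 < ‖g x‖ := by linarith
        have h1 : ‖g x‖ ^ q = ‖g x‖ ^ (q - p) * ‖g x‖ ^ p := by
          rw [← Real.rpow_add hg0]; congr 1; ring
        have h2 : ‖g x‖ ^ (q - p) ≤ a ^ (q - p) :=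
          Real.rpow_le_rpow_of_nonpos ha0 h (by linarith)
        have h3 : 0 ≤ a ^ q := by positivity
        rw [h1]
        have := mul_le_mul_of_nonneg_right h2 (by positivity : 0 ≤ ‖g x‖ ^ p)
        linarith
    have hcst : IntegrableOn (fun _ : E => a ^ q) (ball (0 : E) 1) μ :=
      integrableOn_const measure_ball_lt_top.ne
    have hint2 := (hint p hp0.le).const_mul (a ^ (q - p))
    have h9 : ∫ x in ball (0 : E) 1, ‖g x‖ ^ q ∂μ ≤
        ∫ x in ball (0 : E) 1, (a ^ q + a ^ (q - p) * ‖g x‖ ^ p) ∂μ :=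
      integral_mono (hint q (by linarith)) (hcst.add hint2) hpt
    rw [integral_add hcst hint2, integral_const_mul, setIntegral_const, smul_eq_mul] at h9
    refine h9.trans ?_
    rw [haq, add_mul]
    refine add_le_add le_rfl ?_
    refine (mul_le_mul_of_nonneg_left h5 (by positivity)).trans (le_of_eq ?_)
    rw [← hap, mul_left_comm, ← Real.rpow_add ha0]
    congr 2; ring

end
end HBI

open Metric MeasureTheory
namespace HBI

section

variable {E : Type*} [NormedAddCommGroup E]
  [MeasurableSpace E] [BorelSpace E] [NormedSpace ℝ E]

open scoped Pointwise

theorem scale_int (z₀ : E) (R : ℝ) (hR : 0 < R) (m : Measure E) (c : NNReal) (hc : c ≠ 0)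
    (hm : ∀ t : Set E, m ((fun x => z₀ + R • x) '' t) = (c : ENNReal) * m t) (F : E → ℝ)
    (s : Set E) (t : Set E) (hst : (fun x => z₀ + R • x) ⁻¹' s = t) :
    ∫ x in t, F (z₀ + R • x) ∂m = (c : ℝ)⁻¹ * ∫ x in s, F x ∂m := by
  let e : E ≃ₜ E := (Homeomorph.smulOfNeZero R hR.ne').trans (Homeomorph.addLeft z₀)
  have he : ∀ x, e x = z₀ + R • x := fun x => rfl
  have he' : (e : E → E) = fun x => z₀ + R • x := rfl
  have hmap : Measure.map e m = c⁻¹ • m := by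
    ext u hu
    rw [Measure.map_apply e.continuous.measurable hu]
    have h1 := hm (e ⁻¹' u)
    rw [← he', Set.image_preimage_eq u e.surjective] at h1
    rw [Measure.smul_apply, h1, ENNReal.smul_def, smul_eq_mul, ENNReal.coe_inv hc, ← mul_assoc,
      ENNReal.inv_mul_cancel (by simpa using hc) ENNReal.coe_ne_top, one_mul]
  have h2 := e.measurableEmbedding.setIntegral_map (μ := m) F s
  rw [hmap, Measure.restrict_smul, integral_smul_nnreal_measure, he', hst] at h2
  rw [← h2, NNReal.smul_def]
  simp

theorem scale_haus (k : ℕ) (z₀ : E) (R : ℝ) (hR : 0 < R) (t : Set E) :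
    μH[(k : ℝ)] ((fun x => z₀ + R • x) '' t) = ((R.toNNReal ^ k : NNReal) : ENNReal) *
      μH[(k : ℝ)] t := by
  have : (fun x => z₀ + R • x) '' t = (fun x => z₀ + x) '' (R • t) := by
    rw [← Set.image_smul, Set.image_image]
  rw [this, (isometry_add_left z₀).hausdorffMeasure_image (Or.inl (by positivity)),
    Measure.hausdorffMeasure_smul₀ (by positivity) hR.ne', ENNReal.smul_def, smul_eq_mul,
    NNReal.rpow_natCast]
  congr 3
  ext; simp [hR.le]

theorem scale_haar [FiniteDimensional ℝ E] (μ : Measure E) [μ.IsAddHaarMeasure] (z₀ : E) (R : ℝ)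
    (hR : 0 < R) (t : Set E) :
    μ ((fun x => z₀ + R • x) '' t) =
      ((R.toNNReal ^ (Module.finrank ℝ E) : NNReal) : ENNReal) * μ t := by
  have : (fun x => z₀ + R • x) '' t = (fun x => z₀ + x) '' (R • t) := by
    rw [← Set.image_smul, Set.image_image]
  rw [this, Set.image_add_left, measure_preimage_add, Measure.addHaar_smul,
    abs_of_nonneg (by positivity), ENNReal.ofReal_pow hR.le]
  rfl

end

section

variable {E : Type*} [NormedAddCommGroup E] [NormedSpace ℂ E]
  [MeasurableSpace E] [BorelSpace E]
  [NormedSpace ℝ E] [IsScalarTower ℝ ℂ E] [FiniteDimensional ℝ E]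

theorem scaled (μ : Measure E) [μ.IsAddHaarMeasure] (k : ℕ)
    (hk : Module.finrank ℝ E = k + 1) (p q : ℝ) (hp : 1 ≤ p) (hq : 1 ≤ q)
    (hqp : q * k < (k + 1) * p) (z₀ : E) (R : ℝ) (hR : 0 < R) :
    ∃ δ > (0 : ℝ), ∀ f : E → ℂ, ContinuousOn f (closure (ball z₀ R)) →
      DifferentiableOn ℂ f (ball z₀ R) →
      δ * (∫ z in ball z₀ R, ‖f z‖ ^ q ∂μ) ^ (1 / q)
        ≤ (∫ z in sphere z₀ R, ‖f z‖ ^ p ∂(μH[(k : ℝ)])) ^ (1 / p) := by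
  have hp0 : 0 < p := by linarith
  have hq0 : 0 < q := by linarith
  have hcore : ∃ C : ℝ, 0 ≤ C ∧ ∀ g : E → ℂ, ContinuousOn g (closedBall 0 1) →
      DifferentiableOn ℂ g (ball 0 1) →
      ∫ x in ball (0 : E) 1, ‖g x‖ ^ q ∂μ ≤
        C * (∫ x in sphere (0 : E) 1, ‖g x‖ ^ p ∂(μH[(k : ℝ)])) ^ (q / p) := by
    rcases le_or_gt p q with h | h
    · exact core_ge μ k hk p q hp h hqp
    · exact core_lt μ k hk p q hq h
  obtain ⟨C, hC, hcore⟩ := hcore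
  set a : NNReal := R.toNNReal ^ (Module.finrank ℝ E) with ha
  set b : NNReal := R.toNNReal ^ k with hb
  have hR' : R.toNNReal ≠ 0 := by simpa using hR
  have ha0 : a ≠ 0 := pow_ne_zero _ hR'
  have hb0 : b ≠ 0 := pow_ne_zero _ hR'
  set D : ℝ := a * C * ((b : ℝ)⁻¹) ^ (q / p) with hD
  have hD0 : 0 ≤ D := by positivity
  refine ⟨(D ^ (1 / q) + 1)⁻¹, by positivity, fun f hf hf' => ?_⟩
  have hdist : ∀ x : E, dist (z₀ + R • x) z₀ = R * ‖x‖ := fun x => by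
    rw [dist_eq_norm, add_sub_cancel_left, norm_smul, Real.norm_of_nonneg hR.le]
  have hball : (fun x => z₀ + R • x) ⁻¹' ball z₀ R = ball (0 : E) 1 := by
    ext x
    rw [Set.mem_preimage, mem_ball, hdist, mem_ball_zero_iff, mul_lt_iff_lt_one_right hR]
  have hsph : (fun x => z₀ + R • x) ⁻¹' sphere z₀ R = sphere (0 : E) 1 := by
    ext x
    rw [Set.mem_preimage, mem_sphere, hdist, mem_sphere_zero_iff_norm,
      mul_eq_left₀ hR.ne']
  have hg : ContinuousOn (fun x : E => f (z₀ + R • x)) (closedBall 0 1) := by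
    rw [closure_ball z₀ hR.ne'] at hf
    refine hf.comp (by fun_prop) fun x hx => ?_
    rw [mem_closedBall, hdist]
    rw [mem_closedBall_zero_iff] at hx
    nlinarith
  have hg' : DifferentiableOn ℂ (fun x : E => f (z₀ + R • x)) (ball 0 1) := by
    refine hf'.comp (g := f) (f := fun x => z₀ + R • x) ?_ fun x hx => by
      rw [← hball] at hx; exact hx
    have : (fun x : E => z₀ + R • x) = fun x => z₀ + (R : ℂ) • x := by
      ext x
      rw [← algebraMap_smul ℂ R x]; rfl
    rw [this]
    fun_prop
  have h := hcore _ hg hg'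
  rw [scale_int z₀ R hR μ a ha0 (scale_haar μ z₀ R hR) (fun x => ‖f x‖ ^ q) _ _ hball,
    scale_int z₀ R hR _ b hb0 (scale_haus k z₀ R hR) (fun x => ‖f x‖ ^ p) _ _ hsph] at h
  set I := ∫ z in ball z₀ R, ‖f z‖ ^ q ∂μ
  set A := ∫ z in sphere z₀ R, ‖f z‖ ^ p ∂(μH[(k : ℝ)])
  have hI0 : 0 ≤ I := integral_nonneg fun x => by positivity
  have hA0 : 0 ≤ A := integral_nonneg fun x => by positivity
  have ha0' : (0 : ℝ) < a := by positivity
  have hI : I ≤ D * A ^ (q / p) := by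
    rw [inv_mul_le_iff₀ ha0', Real.mul_rpow (by positivity) hA0] at h
    rw [hD]; linarith
  have h2 := Real.rpow_le_rpow hI0 hI (by positivity : 0 ≤ 1 / q)
  rw [Real.mul_rpow hD0 (by positivity), ← Real.rpow_mul hA0] at h2
  have e : q / p * (1 / q) = 1 / p := by field_simp
  rw [e] at h2
  rw [inv_mul_le_iff₀ (by positivity)]
  have : 0 ≤ A ^ (1 / p) := by positivity
  linarith

end
end HBI

theorem holomorphic_boundary_inequality_ball
    (n : ℕ) (hn : 1 ≤ n) (z₀ : EuclideanSpace ℂ (Fin n)) (R : ℝ) (hR : 0 < R)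
    (p q : ℝ) (hp : 1 ≤ p) (hq : 1 ≤ q) (hqp : q * (2 * n - 1) < 2 * n * p) :
    ∃ δ > (0 : ℝ), ∀ f : EuclideanSpace ℂ (Fin n) → ℂ,
      ContinuousOn f (closure (ball z₀ R)) →
      DifferentiableOn ℂ f (ball z₀ R) →
      δ * (∫ z in ball z₀ R, ‖f z‖ ^ q) ^ (1 / q)
        ≤ (∫ z in sphere z₀ R, ‖f z‖ ^ p ∂(μH[(2 * n : ℝ) - 1])) ^ (1 / p) := by
  have hk : Module.finrank ℝ (EuclideanSpace ℂ (Fin n)) = (2 * n - 1) + 1 := by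
    rw [finrank_real_of_complex, finrank_euclideanSpace_fin]
    omega
  have hc : ((2 * n - 1 : ℕ) : ℝ) = 2 * n - 1 := by
    rw [Nat.cast_sub (by omega)]; push_cast; ring
  have h := HBI.scaled (volume : Measure (EuclideanSpace ℂ (Fin n))) (2 * n - 1) hk p q hp hq
    (by rw [hc]; linarith) z₀ R hR
  rw [hc] at h
  exact h
end
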